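/- arXiv:math/0602135 — 2 statements merged into one kernel-verified Lean document; each statement's English description precedes it below -/
import Mathlib

section
/- Let r₀ > 0 and let f be a continuous positive radial density on ℝ², f(x) = g(|x|), such that g is nondecreasing on [r₀, +∞). Let Ω be an open set contained in {x ∈ ℝ² : |x| ≥ r₀} whose topological boundary is a smooth embedded 1-dimensional submanifold of ℝ², and suppose that P(Ω) < 2π r₀ g(r₀). Then P(Ω)² ≥ 2 g(r₀) vol(Ω). -/
open Filter MeasureTheory Set

/-- Weighted volume of a set `Ω ⊆ ℝ²` with respect to the density `f`. -/
noncomputable def wvol (f : EuclideanSpace ℝ (Fin 2) → ℝ)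
    (Ω : Set (EuclideanSpace ℝ (Fin 2))) : ENNReal :=
  ∫⁻ x in Ω, ENNReal.ofReal (f x)

/-- Weighted perimeter of a set `Ω ⊆ ℝ²` with respect to the density `f`:
the integral of `f` over the topological boundary of `Ω` with respect to the
`1`-dimensional Hausdorff measure. -/
noncomputable def wper (f : EuclideanSpace ℝ (Fin 2) → ℝ)
    (Ω : Set (EuclideanSpace ℝ (Fin 2))) : ENNReal :=
  ∫⁻ x in frontier Ω, ENNReal.ofReal (f x) ∂(μH[1])

/-- `Ω` has smooth boundary: near every boundary point, `Ω` is the sublevel set of a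
smooth function with nonvanishing differential, so that the topological boundary of
`Ω` is a smooth embedded 1-dimensional submanifold of `ℝ²`. -/
def HasSmoothBoundary (Ω : Set (EuclideanSpace ℝ (Fin 2))) : Prop :=
  ∀ p ∈ frontier Ω, ∃ (U : Set (EuclideanSpace ℝ (Fin 2)))
    (φ : EuclideanSpace ℝ (Fin 2) → ℝ), IsOpen U ∧ p ∈ U ∧ ContDiff ℝ (⊤ : ℕ∞) φ ∧
      (∀ q ∈ U, fderiv ℝ φ q ≠ 0) ∧ Ω ∩ U = {q ∈ U | φ q < 0}

theorem aux_dist (r δ : ℝ) (hr : 0 < r) (hδ : 0 < δ) (hδ1 : δ < 1) (z w : ℂ) (hz : r ≤ ‖z‖) (hw : r ≤ ‖w‖)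
    (h : |z.arg - w.arg| ≤ δ) : r * (1 - δ^2) * |z.arg - w.arg| ≤ ‖z - w‖ := by
  have key : ‖z - w‖^2 = (‖z‖ - ‖w‖)^2 + 4 * ‖z‖ * ‖w‖ * (Real.sin (|z.arg - w.arg|/2))^2 := by
    have h1 : Real.cos (|z.arg - w.arg|) = 1 - 2 * (Real.sin (|z.arg - w.arg|/2))^2 := by
      have := Real.cos_two_mul (|z.arg - w.arg|/2)
      have h2 := Real.sin_sq_add_cos_sq (|z.arg - w.arg|/2)
      rw [show 2 * (|z.arg - w.arg|/2) = |z.arg - w.arg| by ring] at this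
      linarith
    rw [Real.cos_abs, Real.cos_sub] at h1
    have e : ‖z - w‖^2 = (z.re - w.re)^2 + (z.im - w.im)^2 := by
      rw [← Complex.normSq_eq_norm_sq, Complex.normSq_apply]; simp; ring
    rw [e, ← Complex.norm_mul_cos_arg z, ← Complex.norm_mul_cos_arg w, ← Complex.norm_mul_sin_arg z, ← Complex.norm_mul_sin_arg w]
    have a := Real.sin_sq_add_cos_sq z.arg
    have b := Real.sin_sq_add_cos_sq w.arg
    linear_combination ‖z‖^2 * a + ‖w‖^2 * b - 2 * ‖z‖ * ‖w‖ * h1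
  set D := |z.arg - w.arg| with hD
  have hD0 : 0 ≤ D := abs_nonneg _
  have hs : D / 2 * (1 - δ^2) ≤ Real.sin (D/2) := by
    rcases hD0.eq_or_lt with h0 | h0
    · rw [← h0]; simp
    · have := Real.sin_gt_sub_cube (x := D/2) (by linarith)
      nlinarith [mul_pos h0 h0, mul_le_mul h h hD0 hδ.le]
  have hδ2 : 0 ≤ 1 - δ^2 := by nlinarith
  refine (sq_le_sq₀ (by positivity) (norm_nonneg _)).1 ?_
  rw [key]
  have h3 : (D / 2 * (1 - δ^2))^2 ≤ (Real.sin (D/2))^2 := by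
    gcongr
  have h4 : r * r ≤ ‖z‖ * ‖w‖ := by gcongr
  have h5 : (r * r) * (D / 2 * (1 - δ^2))^2 ≤ (‖z‖ * ‖w‖) * (Real.sin (D/2))^2 := by gcongr
  nlinarith [sq_nonneg (‖z‖ - ‖w‖)]

theorem aux_sector (r δ : ℝ) (hr : 0 < r) (hδ : 0 < δ) (hδ1 : δ < 1) (G : Set ℂ)
    (hG : ∀ z ∈ G, r ≤ ‖z‖) (hG2 : ∀ z ∈ G, ∀ w ∈ G, |z.arg - w.arg| ≤ δ) :
    ENNReal.ofReal (r * (1 - δ^2)) * volume (Complex.arg '' G) ≤ μH[1] G := by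
  have hc : 0 < r * (1 - δ^2) := mul_pos hr (by nlinarith)
  have hL : LipschitzOnWith (Real.toNNReal ((r * (1 - δ^2))⁻¹)) Complex.arg G := by
    apply LipschitzOnWith.of_dist_le_mul
    intro z hz w hw
    rw [Real.coe_toNNReal _ (by positivity), Real.dist_eq, dist_eq_norm, inv_mul_eq_div, le_div_iff₀ hc, mul_comm]
    exact aux_dist r δ hr hδ hδ1 z w (hG z hz) (hG w hw) (hG2 z hz w hw)
  have := hL.hausdorffMeasure_image_le (d := 1) zero_le_one
  rw [hausdorffMeasure_real, ENNReal.rpow_one] at this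
  calc _ ≤ ENNReal.ofReal (r * (1 - δ^2)) * (ENNReal.ofReal ((r * (1 - δ^2))⁻¹) * μH[1] G) := by
        gcongr; exact this
    _ = _ := by
        rw [← mul_assoc, ← ENNReal.ofReal_mul hc.le, mul_inv_cancel₀ hc.ne', ENNReal.ofReal_one, one_mul]

theorem aux_arg (r : ℝ) (hr : 0 < r) (G : Set ℂ) (hGm : MeasurableSet G)
    (hG : ∀ z ∈ G, r ≤ ‖z‖) :
    ENNReal.ofReal r * volume (Complex.arg '' G) ≤ μH[1] G := by
  have main : ∀ δ : ℝ, 0 < δ → δ < 1 → 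
      ENNReal.ofReal (r * (1 - δ^2)) * volume (Complex.arg '' G) ≤ μH[1] G := by
    intro δ hδ hδ1
    let p : ℂ → ℤ := fun z => ⌊z.arg / δ⌋
    have hp : Measurable p := Int.measurable_floor.comp (Complex.measurable_arg.div_const δ)
    have hU : G = ⋃ k : ℤ, G ∩ p ⁻¹' {k} := by
      ext z; simp
    have hm : μH[1] G = ∑' k : ℤ, μH[1] (G ∩ p ⁻¹' {k}) := by
      conv_lhs => rw [hU]
      apply measure_iUnion
      · intro i j hij
        refine Set.disjoint_left.2 ?_
        rintro z ⟨_, h1⟩ ⟨_, h2⟩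
        exact hij (h1.symm.trans h2)
      · intro k
        exact hGm.inter (hp (measurableSet_singleton k))
    rw [hm]
    calc _ ≤ ENNReal.ofReal (r * (1 - δ^2)) * ∑' k : ℤ, volume (Complex.arg '' (G ∩ p ⁻¹' {k})) := by
          gcongr
          conv_lhs => rw [hU, image_iUnion]
          exact measure_iUnion_le _
      _ ≤ _ := by
          rw [← ENNReal.tsum_mul_left]
          refine ENNReal.tsum_le_tsum fun k => ?_
          apply aux_sector r δ hr hδ hδ1 _ (fun z hz => hG z hz.1)
          rintro z ⟨_, hz⟩ w ⟨_, hw⟩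
          have := Int.abs_sub_lt_one_of_floor_eq_floor (show ⌊z.arg / δ⌋ = ⌊w.arg / δ⌋ from hz.trans hw.symm)
          rw [← sub_div, abs_div, abs_of_pos hδ, div_lt_one hδ] at this
          exact this.le
  have ht : Tendsto (fun δ : ℝ => ENNReal.ofReal (r * (1 - δ^2)) * volume (Complex.arg '' G)) (nhdsWithin 0 (Ioi 0))
      (nhds (ENNReal.ofReal (r * (1 - 0^2)) * volume (Complex.arg '' G))) := by
    apply ENNReal.Tendsto.mul_const
    · apply ENNReal.tendsto_ofReal
      exact tendsto_nhdsWithin_of_tendsto_nhds (Continuous.tendsto (by fun_prop) 0)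
    · left; simp [hr]
  simp only [ne_eq, OfNat.ofNat_ne_zero, not_false_eq_true, zero_pow, sub_zero, mul_one] at ht
  apply le_of_tendsto ht
  filter_upwards [Ioo_mem_nhdsGT (zero_lt_one (α := ℝ))] with δ hδ using main δ hδ.1 hδ.2

theorem aux_conn (Ω : Set ℂ) (hΩ : IsOpen Ω) (s : Set ℝ) (hs : IsPreconnected s) (γ : ℝ → ℂ) (hγ : Continuous γ)
    (a b : ℝ) (ha : a ∈ s) (hb : b ∈ s) (haΩ : γ a ∈ Ω) (hbΩ : γ b ∉ Ω) : ∃ t ∈ s, γ t ∈ frontier Ω := by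
  by_contra! hcon
  have hcov : s ⊆ γ ⁻¹' Ω ∪ γ ⁻¹' (closure Ω)ᶜ := by
    intro t ht
    by_cases h : γ t ∈ closure Ω
    · left
      by_contra h2
      exact hcon t ht (by rw [hΩ.frontier_eq]; exact ⟨h, h2⟩)
    · right; exact h
  have hb' : b ∈ γ ⁻¹' (closure Ω)ᶜ := (hcov hb).resolve_left hbΩ
  obtain ⟨t, _, h1, h2⟩ := hs _ _ (hΩ.preimage hγ) (isClosed_closure.isOpen_compl.preimage hγ) hcov
    ⟨a, ha, haΩ⟩ ⟨b, hb, hb'⟩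
  exact h2 (subset_closure h1)

/-- polar point -/
noncomputable def pp (r t : ℝ) : ℂ := r * (Complex.cos t + Complex.sin t * Complex.I)

theorem pp_cont : Continuous (fun p : ℝ × ℝ => pp p.1 p.2) := by unfold pp; fun_prop

theorem pp_norm (r t : ℝ) (hr : 0 < r) : ‖pp r t‖ = r := by
  rw [pp, norm_mul, Complex.norm_cos_add_sin_mul_I]; simp [abs_of_pos hr]

theorem pp_arg (r t : ℝ) (hr : 0 < r) (ht : t ∈ Ioc (-Real.pi) Real.pi) : (pp r t).arg = t :=
  Complex.arg_mul_cos_add_sin_mul_I hr ht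

theorem pp_norm_arg (z : ℂ) : pp ‖z‖ z.arg = z := Complex.norm_mul_cos_add_sin_mul_I z

theorem pp_neg_pi (r : ℝ) : pp r (-Real.pi) = pp r Real.pi := by simp [pp]

/-- two boundary points on each circle -/
theorem aux_two (Ω : Set ℂ) (hΩ : IsOpen Ω) (h0 : (0:ℂ) ∉ Ω) (c : ℂ) (hc : ‖c‖ = 1)
    (hmiss : ∀ r > 0, c * pp r Real.pi ∉ Ω ∧ c * pp r Real.pi ∉ frontier Ω) :
    2 * volume (norm '' Ω) ≤ μH[1] (frontier Ω) := by
  have hc0 : c ≠ 0 := by intro h; simp [h] at hc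
  have hF : MeasurableSet (frontier Ω) := isClosed_frontier.measurableSet
  let ag : ℂ → ℝ := fun z => (c⁻¹ * z).arg
  have hag : Measurable ag := Complex.measurable_arg.comp (measurable_const_mul _)
  let U : ℚ → Set ℝ := fun q => {r | 0 < r ∧ (q : ℝ) ∈ Ioo (-Real.pi) Real.pi ∧ c * pp r q ∈ Ω}
  have hUo : ∀ q, IsOpen (U q) := by
    intro q
    refine isOpen_lt continuous_const continuous_id |>.inter (isOpen_const.inter (hΩ.preimage ?_))
    exact continuous_const.mul (pp_cont.comp (continuous_id.prodMk continuous_const))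
  have hcr : ∀ r, Continuous fun t => c * pp r t := fun r =>
    continuous_const.mul (pp_cont.comp (continuous_const.prodMk continuous_id))
  have hcov : norm '' Ω ⊆ ⋃ q, U q := by
    rintro _ ⟨z, hz, rfl⟩
    have hz0 : z ≠ 0 := fun h => h0 (h ▸ hz)
    have hr : 0 < ‖z‖ := norm_pos_iff.2 hz0
    have hzz : c * pp ‖z‖ (ag z) = z := by
      have h1 : ‖c⁻¹ * z‖ = ‖z‖ := by rw [norm_mul, norm_inv, hc]; simp
      have := pp_norm_arg (c⁻¹ * z)
      rw [h1] at this
      simp only [ag, this]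
      field_simp
    have hlt : ag z ∈ Ioo (-Real.pi) Real.pi := by
      refine ⟨Complex.neg_pi_lt_arg _, lt_of_le_of_ne (Complex.arg_le_pi _) ?_⟩
      intro h
      change ag z = Real.pi at h
      rw [h] at hzz
      exact (hmiss _ hr).1 (by rw [hzz]; exact hz)
    have hop : IsOpen (Ioo (-Real.pi) Real.pi ∩ (fun t => c * pp ‖z‖ t) ⁻¹' Ω) :=
      isOpen_Ioo.inter (hΩ.preimage (hcr _))
    obtain ⟨q, hq⟩ := (Rat.denseRange_cast (𝕜 := ℝ)).exists_mem_open hop ⟨ag z, hlt, by simpa [hzz] using hz⟩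
    exact mem_iUnion.2 ⟨q, hr, hq.1, hq.2⟩
  have hnl : ∀ s : Set ℂ, volume (norm '' s) ≤ μH[1] s := by
    intro s
    have := (LipschitzWith.lipschitzOnWith (s := s) (lipschitzWith_one_norm (E := ℂ))).hausdorffMeasure_image_le (d := 1) zero_le_one
    simpa [hausdorffMeasure_real] using this
  have hpiece : ∀ q, ∀ S : Set ℝ, MeasurableSet S → S ⊆ U q →
      2 * volume S ≤ μH[1] (frontier Ω ∩ norm ⁻¹' S) := by
    intro q S hS hSU
    have hargc : ∀ r > 0, ∀ t ∈ Ioc (-Real.pi) Real.pi, ag (c * pp r t) = t := by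
      intro r hr t ht
      simp only [ag, inv_mul_cancel_left₀ hc0]
      exact pp_arg r t hr ht
    have hnc : ∀ r > 0, ∀ t, ‖c * pp r t‖ = r := by
      intro r hr t; rw [norm_mul, hc, one_mul, pp_norm r t hr]
    have hA : S ⊆ norm '' ((frontier Ω ∩ norm ⁻¹' S) ∩ ag ⁻¹' (Ioi q)) := by
      intro r hrS
      obtain ⟨hr, hq, hin⟩ := hSU hrS
      obtain ⟨t, ht, htF⟩ := aux_conn Ω hΩ (Icc q Real.pi) isPreconnected_Icc (fun t => c * pp r t) (hcr r) q Real.pi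
        ⟨le_rfl, hq.2.le⟩ ⟨hq.2.le, le_rfl⟩ hin (hmiss r hr).1
      have htq : (q:ℝ) ≠ t := by
        rintro rfl
        exact (hΩ.inter_frontier_eq.le ⟨hin, htF⟩)
      refine ⟨c * pp r t, ⟨⟨htF, ?_⟩, ?_⟩, hnc r hr t⟩
      · rw [mem_preimage, hnc r hr t]; exact hrS
      · simp only [mem_preimage, mem_Ioi]
        rw [hargc r hr t ⟨hq.1.trans_le ht.1, ht.2⟩]
        exact lt_of_le_of_ne ht.1 htq
    have hB : S ⊆ norm '' ((frontier Ω ∩ norm ⁻¹' S) \ ag ⁻¹' (Ioi q)) := by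
      intro r hrS
      obtain ⟨hr, hq, hin⟩ := hSU hrS
      obtain ⟨t, ht, htF⟩ := aux_conn Ω hΩ (Icc (-Real.pi) q) isPreconnected_Icc (fun t => c * pp r t) (hcr r) q (-Real.pi)
        ⟨hq.1.le, le_rfl⟩ ⟨le_rfl, hq.1.le⟩ hin (by simpa only [pp_neg_pi] using (hmiss r hr).1)
      have htq : -Real.pi ≠ t := by
        rintro rfl
        simp only [pp_neg_pi] at htF
        exact (hmiss r hr).2 htF
      refine ⟨c * pp r t, ⟨⟨htF, ?_⟩, ?_⟩, hnc r hr t⟩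
      · rw [mem_preimage, hnc r hr t]; exact hrS
      · simp only [mem_preimage, mem_Ioi]
        rw [hargc r hr t ⟨lt_of_le_of_ne ht.1 htq, ht.2.trans hq.2.le⟩]
        exact not_lt.2 ht.2
    rw [← measure_inter_add_sdiff (frontier Ω ∩ norm ⁻¹' S) (hag (measurableSet_Ioi (a := (q:ℝ)))), two_mul]
    exact add_le_add ((measure_mono hA).trans (hnl _)) ((measure_mono hB).trans (hnl _))
  -- sum over a disjointification
  obtain ⟨e⟩ : Nonempty (ℕ ≃ ℚ) := ⟨(Denumerable.eqv ℚ).symm⟩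
  let V : ℕ → Set ℝ := disjointed (fun n => U (e n))
  have hVm : ∀ n, MeasurableSet (V n) := fun n =>
    MeasurableSet.disjointed (fun n => (hUo (e n)).measurableSet) n
  have hVU : ⋃ n, V n = ⋃ q, U q := by
    rw [iUnion_disjointed]
    exact e.surjective.iUnion_comp U
  have hVd : Pairwise (Function.onFun Disjoint V) := disjoint_disjointed _
  calc 2 * volume (norm '' Ω) ≤ 2 * ∑' n, volume (V n) := by
        gcongr
        refine (measure_mono hcov).trans ?_
        rw [← hVU]; exact measure_iUnion_le _
    _ ≤ ∑' n, μH[1] (frontier Ω ∩ norm ⁻¹' (V n)) := by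
        rw [← ENNReal.tsum_mul_left]
        exact ENNReal.tsum_le_tsum fun n => hpiece (e n) _ (hVm n) (disjointed_subset _ n)
    _ = μH[1] (⋃ n, frontier Ω ∩ norm ⁻¹' (V n)) := by
        symm
        apply measure_iUnion
        · intro i j hij
          exact ((hVd hij).preimage norm).mono inter_subset_right inter_subset_right
        · intro n
          exact hF.inter (measurable_norm (hVm n))
    _ ≤ _ := measure_mono (iUnion_subset fun n => inter_subset_left)

theorem main_C (r₀ : ℝ) (hr₀ : 0 < r₀) (f : ℂ → ℝ) (g : ℝ → ℝ)
    (hcont : Continuous f) (hpos : ∀ x, 0 < f x)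
    (hfg : ∀ x : ℂ, f x = g ‖x‖)
    (hgmono : ∀ r s : ℝ, r₀ ≤ r → r ≤ s → g r ≤ g s)
    (Ω : Set ℂ) (hΩ : IsOpen Ω)
    (hΩsub : Ω ⊆ {x : ℂ | r₀ ≤ ‖x‖})
    (P : ENNReal) (hPdef : P = ∫⁻ x in frontier Ω, ENNReal.ofReal (f x) ∂(μH[1]))
    (hP : P < ENNReal.ofReal (2 * Real.pi * r₀ * g r₀)) :
    ENNReal.ofReal (2 * g r₀) * (∫⁻ x in Ω, ENNReal.ofReal (f x)) ≤ P ^ 2 := by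
  have hg0 : 0 < g r₀ := by
    have := hpos (r₀ : ℂ)
    rwa [hfg, Complex.norm_real, Real.norm_of_nonneg hr₀.le] at this
  have hFsub : ∀ z ∈ frontier Ω, r₀ ≤ ‖z‖ := by
    intro z hz
    exact closure_minimal hΩsub (isClosed_le continuous_const continuous_norm) (frontier_subset_closure hz)
  have hFm : MeasurableSet (frontier Ω) := isClosed_frontier.measurableSet
  have hPr : ∀ r, r₀ ≤ r → ENNReal.ofReal (g r) * μH[1] (frontier Ω ∩ {z | r ≤ ‖z‖}) ≤ P := by
    intro r hr
    have hm : MeasurableSet (frontier Ω ∩ {z : ℂ | r ≤ ‖z‖}) :=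
      hFm.inter (measurableSet_le measurable_const measurable_norm)
    rw [← setLIntegral_const, hPdef]
    calc _ ≤ ∫⁻ x in frontier Ω ∩ {z : ℂ | r ≤ ‖z‖}, ENNReal.ofReal (f x) ∂(μH[1]) := by
          apply setLIntegral_mono' hm
          intro x hx
          apply ENNReal.ofReal_le_ofReal
          rw [hfg]; exact hgmono r _ hr hx.2
      _ ≤ _ := lintegral_mono_set inter_subset_left
  have hP0 : ENNReal.ofReal (g r₀) * μH[1] (frontier Ω) ≤ P := by
    have := hPr r₀ le_rfl
    rwa [inter_eq_left.2 (show frontier Ω ⊆ {z : ℂ | r₀ ≤ ‖z‖} from hFsub)] at this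
  have hPtop : P ≠ ⊤ := hP.ne_top
  have hcray : ∀ t, Continuous fun r => pp r t := fun t =>
    pp_cont.comp (continuous_id.prodMk continuous_const)
  -- a missed ray
  obtain ⟨θ, hθ, hθF⟩ : ∃ θ ∈ Ioc (-Real.pi) Real.pi, θ ∉ Complex.arg '' frontier Ω := by
    by_contra! hcon
    have h1 : volume (Ioc (-Real.pi) Real.pi) ≤ volume (Complex.arg '' frontier Ω) := measure_mono hcon
    have h2 := aux_arg r₀ hr₀ _ hFm hFsub
    rw [Real.volume_Ioc] at h1
    refine absurd hP (not_lt.2 ?_)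
    calc _ = ENNReal.ofReal (g r₀) * (ENNReal.ofReal r₀ * ENNReal.ofReal (Real.pi - -Real.pi)) := by
          rw [← ENNReal.ofReal_mul hr₀.le, ← ENNReal.ofReal_mul hg0.le]; congr 1; ring
      _ ≤ ENNReal.ofReal (g r₀) * (ENNReal.ofReal r₀ * volume (Complex.arg '' frontier Ω)) := by gcongr
      _ ≤ ENNReal.ofReal (g r₀) * μH[1] (frontier Ω) := by gcongr
      _ ≤ P := hP0
  have hmissF : ∀ r > 0, pp r θ ∉ frontier Ω := by
    intro r hr h
    exact hθF ⟨_, h, pp_arg r θ hr hθ⟩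
  have hmissΩ : ∀ r > 0, pp r θ ∉ Ω := by
    intro r hr h
    obtain ⟨t, ht, htF⟩ := aux_conn Ω hΩ (Ioi 0) isPreconnected_Ioi (fun r => pp r θ) (hcray θ) r (r₀/2) hr
      (half_pos hr₀) h (by
        intro h'
        have := hΩsub h'
        simp only [mem_ofPred_eq] at this
        rw [pp_norm _ _ (half_pos hr₀)] at this
        linarith)
    exact hmissF t ht htF
  have h0 : (0:ℂ) ∉ Ω := by
    intro h
    have := hΩsub h
    simp only [mem_ofPred_eq, norm_zero] at this
    linarith
  have htwo : 2 * volume (norm '' Ω) ≤ μH[1] (frontier Ω) := by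
    have hcp : ∀ r : ℝ, (-(Complex.cos θ + Complex.sin θ * Complex.I)) * pp r Real.pi = pp r θ := by
      intro r; simp [pp]; ring
    apply aux_two Ω hΩ h0 (-(Complex.cos θ + Complex.sin θ * Complex.I))
    · rw [norm_neg, Complex.norm_cos_add_sin_mul_I]
    · intro r hr
      rw [hcp]
      exact ⟨hmissΩ r hr, hmissF r hr⟩
  have hHtop : μH[1] (frontier Ω) ≠ ⊤ := by
    intro h
    rw [h, ENNReal.mul_top (by simpa using hg0)] at hP0
    exact hPtop (top_le_iff.1 hP0)
  have hRtop : volume (norm '' Ω) ≠ ⊤ := by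
    intro h
    rw [h, ENNReal.mul_top (by norm_num)] at htwo
    exact hHtop (top_le_iff.1 htwo)
  -- outward hitting
  have hout : ∀ r > 0, ∀ t, pp r t ∈ Ω → ∃ ρ ≥ r, pp ρ t ∈ frontier Ω := by
    intro r hr t h
    by_contra! hcon
    apply hRtop
    rw [← top_le_iff, ← Real.volume_Ici (a := r)]
    apply measure_mono
    intro ρ hρ
    refine ⟨pp ρ t, ?_, pp_norm _ _ (hr.trans_le hρ)⟩
    by_contra hn
    obtain ⟨s, hs, hsF⟩ := aux_conn Ω hΩ (Ici r) isPreconnected_Ici (fun r => pp r t) (hcray t) r ρ self_mem_Ici hρ h hn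
    exact hcon s hs hsF
  have hslice : ∀ r > 0, ENNReal.ofReal r * ENNReal.ofReal (g r) *
      volume {t | t ∈ Ioo (-Real.pi) Real.pi ∧ pp r t ∈ Ω} ≤ (norm '' Ω).indicator (fun _ => P) r := by
    intro r hr
    by_cases hrR : r ∈ norm '' Ω
    · rw [indicator_of_mem hrR]
      have hrr : r₀ ≤ r := by
        obtain ⟨z, hz, rfl⟩ := hrR
        exact hΩsub hz
      have hsub : {t | t ∈ Ioo (-Real.pi) Real.pi ∧ pp r t ∈ Ω} ⊆ Complex.arg '' (frontier Ω ∩ {z | r ≤ ‖z‖}) := by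
        rintro t ⟨ht, htΩ⟩
        obtain ⟨ρ, hρ, hρF⟩ := hout r hr t htΩ
        have hρ0 : 0 < ρ := hr.trans_le hρ
        refine ⟨pp ρ t, ⟨hρF, ?_⟩, pp_arg ρ t hρ0 ⟨ht.1, ht.2.le⟩⟩
        rw [mem_ofPred_eq, pp_norm ρ t hρ0]; exact hρ
      calc _ ≤ ENNReal.ofReal (g r) * (ENNReal.ofReal r * volume (Complex.arg '' (frontier Ω ∩ {z | r ≤ ‖z‖}))) := by
            rw [mul_comm (ENNReal.ofReal r), mul_assoc]
            gcongr
        _ ≤ ENNReal.ofReal (g r) * μH[1] (frontier Ω ∩ {z | r ≤ ‖z‖}) := by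
            gcongr
            exact aux_arg r hr _ (hFm.inter (measurableSet_le measurable_const measurable_norm)) (fun z hz => hz.2)
        _ ≤ P := hPr r hrr
    · rw [indicator_of_notMem hrR]
      have : {t | t ∈ Ioo (-Real.pi) Real.pi ∧ pp r t ∈ Ω} = ∅ := by
        ext t
        simp only [mem_ofPred_eq, mem_empty_iff_false, iff_false, not_and]
        intro _ h
        exact hrR ⟨_, h, pp_norm _ _ hr⟩
      rw [this]; simp
  have hRm : MeasurableSet (norm '' Ω) := by
    have : norm '' Ω = ⋃ t : ℝ, {r | 0 < r ∧ pp r t ∈ Ω} := by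
      ext r
      simp only [mem_image, mem_iUnion, mem_ofPred_eq]
      constructor
      · rintro ⟨z, hz, rfl⟩
        exact ⟨z.arg, norm_pos_iff.2 (fun h => h0 (h ▸ hz)), by rwa [pp_norm_arg]⟩
      · rintro ⟨t, hr, h⟩
        exact ⟨_, h, pp_norm _ _ hr⟩
    rw [this]
    exact (isOpen_iUnion fun t => (isOpen_lt continuous_const continuous_id).inter (hΩ.preimage (hcray t))).measurableSet
  have hvol : (∫⁻ x in Ω, ENNReal.ofReal (f x)) ≤ P * volume (norm '' Ω) := by
    rw [← lintegral_indicator hΩ.measurableSet, ← Complex.lintegral_comp_polarCoord_symm]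
    have hpp : ∀ p : ℝ × ℝ, Complex.polarCoord.symm p = pp p.1 p.2 := by
      intro p; rw [Complex.polarCoord_symm_apply]; simp [pp]
    simp only [hpp, polarCoord_target, smul_eq_mul]
    rw [Measure.volume_eq_prod, setLIntegral_prod]
    · calc _ ≤ ∫⁻ r in Ioi (0:ℝ), (norm '' Ω).indicator (fun _ => P) r := by
            apply setLIntegral_mono' measurableSet_Ioi
            intro r hr
            refine le_trans (le_of_eq ?_) (hslice r hr)
            have hms : MeasurableSet {t | pp r t ∈ Ω} :=
              (hΩ.preimage (pp_cont.comp (continuous_const.prodMk continuous_id))).measurableSet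
            have : ∀ t, ENNReal.ofReal r * Ω.indicator (fun x => ENNReal.ofReal (f x)) (pp r t) =
                {t | pp r t ∈ Ω}.indicator (fun _ => ENNReal.ofReal r * ENNReal.ofReal (g r)) t := by
              intro t
              by_cases h : pp r t ∈ Ω
              · rw [indicator_of_mem h, indicator_of_mem (by exact h), hfg, pp_norm _ _ hr]
              · rw [indicator_of_notMem h, indicator_of_notMem (by exact h), mul_zero]
            simp only [this]
            rw [lintegral_indicator hms, setLIntegral_const, Measure.restrict_apply hms]
            congr 2
            ext t; simp only [mem_inter_iff, mem_ofPred_eq]; tauto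
        _ ≤ ∫⁻ r, (norm '' Ω).indicator (fun _ => P) r := setLIntegral_le_lintegral _ _
        _ = _ := by rw [lintegral_indicator hRm, setLIntegral_const]
    · apply Measurable.aemeasurable
      apply Measurable.mul
      · fun_prop
      · refine Measurable.comp (g := Ω.indicator (fun x => ENNReal.ofReal (f x))) ?_ pp_cont.measurable
        exact (hcont.measurable.ennreal_ofReal).indicator hΩ.measurableSet
  calc _ ≤ ENNReal.ofReal (2 * g r₀) * (P * volume (norm '' Ω)) := by gcongr
    _ = P * (ENNReal.ofReal (g r₀) * (2 * volume (norm '' Ω))) := by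
        rw [ENNReal.ofReal_mul zero_le_two, ENNReal.ofReal_ofNat]; ring
    _ ≤ P * (ENNReal.ofReal (g r₀) * μH[1] (frontier Ω)) := by gcongr
    _ ≤ P * P := by gcongr
    _ = P ^ 2 := (sq P).symm

/-- Isoperimetric inequality in an outer annulus for a planar radial
density that is nondecreasing on `[r₀, ∞)`:  if `Ω ⊆ {|x| ≥ r₀}` is open with smooth
boundary and `P(Ω) < 2π r₀ g(r₀)`, then `P(Ω)² ≥ 2 g(r₀) vol(Ω)`. -/
theorem sq_wper_ge_of_planar_radial
    (r₀ : ℝ) (hr₀ : 0 < r₀) (f : EuclideanSpace ℝ (Fin 2) → ℝ) (g : ℝ → ℝ)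
    (hcont : Continuous f) (hpos : ∀ x, 0 < f x)
    (hfg : ∀ x : EuclideanSpace ℝ (Fin 2), f x = g ‖x‖)
    (hgmono : ∀ r s : ℝ, r₀ ≤ r → r ≤ s → g r ≤ g s)
    (Ω : Set (EuclideanSpace ℝ (Fin 2))) (hΩopen : IsOpen Ω)
    (hΩsub : Ω ⊆ {x : EuclideanSpace ℝ (Fin 2) | r₀ ≤ ‖x‖})
    (hΩsmooth : HasSmoothBoundary Ω)
    (hP : wper f Ω < ENNReal.ofReal (2 * Real.pi * r₀ * g r₀)) :
    ENNReal.ofReal (2 * g r₀) * wvol f Ω ≤ (wper f Ω) ^ 2 := by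
  let e : ℂ ≃ₗᵢ[ℝ] EuclideanSpace ℝ (Fin 2) := Complex.orthonormalBasisOneI.repr
  have hmp : MeasurePreserving e volume volume := e.measurePreserving
  have hmh : MeasurePreserving e (μH[1]) (μH[1]) := e.toIsometryEquiv.measurePreserving_hausdorffMeasure 1
  have hme : MeasurableEmbedding e := e.toHomeomorph.measurableEmbedding
  have hfr : frontier (e ⁻¹' Ω) = e ⁻¹' frontier Ω := (e.toHomeomorph.preimage_frontier Ω).symm
  have hper : wper f Ω = ∫⁻ x in frontier (e ⁻¹' Ω), ENNReal.ofReal (f (e x)) ∂(μH[1]) := by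
    rw [hfr, hmh.setLIntegral_comp_preimage_emb hme (fun x => ENNReal.ofReal (f x))]; rfl
  have hvol : wvol f Ω = ∫⁻ x in e ⁻¹' Ω, ENNReal.ofReal (f (e x)) := by
    rw [hmp.setLIntegral_comp_preimage_emb hme (fun x => ENNReal.ofReal (f x))]; rfl
  rw [hvol]
  refine main_C r₀ hr₀ (fun x => f (e x)) g (hcont.comp e.continuous) (fun x => hpos _) ?_ hgmono
    (e ⁻¹' Ω) (hΩopen.preimage e.continuous) ?_ _ hper hP
  · intro x; rw [hfg, e.norm_map]
  · intro x hx
    have := hΩsub hx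
    simpa using this
end

section
/- Let f be a continuous radial density on ℝ², f(x) = g(|x|), where g : [0,∞) → (0,∞) is nondecreasing and g(r) → +∞ as r → +∞. Then for every V > 0 there exists an open set Ω ⊆ ℝ² which is an isoperimetric region of volume V. -/
open Filter MeasureTheory Set

/-- `Ω` is an isoperimetric region (minimizer) of weighted volume `V` in `ℝ²`. -/
def IsIsopRegion (f : EuclideanSpace ℝ (Fin 2) → ℝ)
    (Ω : Set (EuclideanSpace ℝ (Fin 2))) (V : ENNReal) : Prop :=
  IsOpen Ω ∧ wvol f Ω = V ∧
    ∀ U : Set (EuclideanSpace ℝ (Fin 2)), IsOpen U → wvol f U = V →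
      wper f Ω ≤ wper f U

section
open Set MeasureTheory Filter Topology Metric
open scoped ENNReal NNReal MeasureTheory

namespace Isop

theorem mult2 {E : Set ℂ} {u : ℂ → ℝ} (hu : LipschitzWith 1 u) {a b : ℝ}
    (h : ∀ t ∈ Ioo a b, ∃ x ∈ E, ∃ y ∈ E, x ≠ y ∧ u x = t ∧ u y = t) :
    2 * ENNReal.ofReal (b - a) ≤ μH[1] E := by
  set T : ℕ → Set ℝ := fun k => {t | t ∈ Ioo a b ∧ ∃ x ∈ E, ∃ y ∈ E,
    ENNReal.ofReal (1 / ((k : ℝ) + 1)) < edist x y ∧ u x = t ∧ u y = t} with hT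
  have hmono : Monotone T := by
    intro k l hkl t ht
    obtain ⟨ht, x, hx, y, hy, hd, h1, h2⟩ := ht
    refine ⟨ht, x, hx, y, hy, lt_of_le_of_lt ?_ hd, h1, h2⟩
    apply ENNReal.ofReal_le_ofReal
    apply one_div_le_one_div_of_le
    · positivity
    · have : (k : ℝ) ≤ l := by exact_mod_cast hkl
      linarith
  have hU : ⋃ k, T k = Ioo a b := by
    ext t
    simp only [mem_iUnion]
    constructor
    · rintro ⟨k, hk⟩; exact hk.1
    · intro ht
      obtain ⟨x, hx, y, hy, hxy, h1, h2⟩ := h t ht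
      obtain ⟨k, hk⟩ := exists_nat_one_div_lt (dist_pos.2 hxy)
      refine ⟨k, ht, x, hx, y, hy, ?_, h1, h2⟩
      rw [edist_dist]
      exact (ENNReal.ofReal_lt_ofReal_iff (dist_pos.2 hxy)).2 hk
  have hvol : ENNReal.ofReal (b - a) = ⨆ k, volume (T k) := by
    rw [← Real.volume_Ioo, ← hU, hmono.measure_iUnion]
  rw [hvol, ENNReal.mul_iSup]
  apply iSup_le
  intro k
  rw [Measure.hausdorffMeasure_apply]
  refine le_iSup₂_of_le (ENNReal.ofReal (1 / ((k : ℝ) + 1))) (by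
    rw [ENNReal.ofReal_pos]; positivity) ?_
  refine le_iInf fun C => le_iInf fun hC => le_iInf fun hd => ?_
  have h1 : ∀ n, volume (closure (u '' C n)) ≤ ⨆ _ : (C n).Nonempty, ediam (C n) ^ (1 : ℝ) := by
    intro n
    rcases (C n).eq_empty_or_nonempty with h0 | h0
    · simp [h0]
    · refine le_trans ?_ (le_iSup_of_le h0 le_rfl)
      refine (Real.volume_le_diam _).trans ?_
      rw [ENNReal.rpow_one, ediam_closure]
      simpa using hu.ediam_image_le (C n)
  refine le_trans ?_ (ENNReal.tsum_le_tsum h1)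
  have h2 : ∑' n, volume (closure (u '' C n)) =
      ∫⁻ t, ∑' n, (closure (u '' C n)).indicator (fun _ => (1 : ℝ≥0∞)) t := by
    rw [lintegral_tsum]
    · congr 1; ext n
      rw [lintegral_indicator isClosed_closure.measurableSet]; simp
    · intro n
      exact (measurable_const.indicator isClosed_closure.measurableSet).aemeasurable
  rw [h2]
  refine le_trans ?_ (mul_meas_ge_le_lintegral ?_ 2)
  · gcongr
    rintro t ⟨ht, x, hx, y, hy, hxy, h1, h2⟩
    obtain ⟨i, hi⟩ := mem_iUnion.1 (hC hx)
    obtain ⟨j, hj⟩ := mem_iUnion.1 (hC hy)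
    have hij : i ≠ j := by
      rintro rfl
      exact absurd ((edist_le_ediam_of_mem hi hj).trans (hd i)) (not_le.2 hxy)
    have := ENNReal.sum_le_tsum (f := fun n =>
      (closure (u '' C n)).indicator (fun _ => (1 : ℝ≥0∞)) t) {i, j}
    simp only [mem_ofPred_eq]
    refine le_trans ?_ this
    rw [Finset.sum_pair hij, indicator_of_mem, indicator_of_mem]
    · norm_num
    · exact subset_closure ⟨y, hj, h2⟩
    · exact subset_closure ⟨x, hi, h1⟩
  · apply Measurable.tsum
    intro n
    exact measurable_const.indicator isClosed_closure.measurableSet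

/-- one-point version -/
theorem mult1 {E : Set ℂ} {u : ℂ → ℝ} (hu : LipschitzWith 1 u) {S : Set ℝ}
    (h : S ⊆ u '' E) : volume S ≤ μH[1] E := by
  rw [← hausdorffMeasure_real]
  refine (measure_mono h).trans ?_
  simpa using hu.hausdorffMeasure_image_le zero_le_one E

theorem pre_ball_le {d : ℝ≥0∞} (x : ℂ) {r : ℝ} (hd : ENNReal.ofReal (2 * r) ≤ d) :
    OuterMeasure.mkMetric'.pre (fun s : Set ℂ => ediam s ^ (1 : ℝ)) d (closedBall x r)
      ≤ ENNReal.ofReal (2 * r) := by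
  have h : ediam (closedBall x r) ≤ ENNReal.ofReal (2 * r) := by
    refine ediam_le_of_forall_dist_le fun a ha b hb => ?_
    have := dist_triangle_right a b x
    simp only [mem_closedBall] at ha hb
    linarith
  refine (OuterMeasure.mkMetric'.pre_le (h.trans hd)).trans ?_
  simpa using h

theorem H_eq_iSup_pre (s : Set ℂ) : (μH[1] : Measure ℂ) s =
    ⨆ n : ℕ, OuterMeasure.mkMetric'.pre (fun s : Set ℂ => ediam s ^ (1 : ℝ)) (n : ℝ≥0∞)⁻¹ s := by
  have : (μH[1] : Measure ℂ) s = OuterMeasure.mkMetric (fun r : ℝ≥0∞ => r ^ (1 : ℝ)) s := by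
    rw [OuterMeasure.coe_mkMetric]; rfl
  rw [this, OuterMeasure.mkMetric, OuterMeasure.mkMetric'.eq_iSup_nat]
  simp [OuterMeasure.iSup_apply]

theorem pre_le_H (s : Set ℂ) (n : ℕ) :
    OuterMeasure.mkMetric'.pre (fun s : Set ℂ => ediam s ^ (1 : ℝ)) (n : ℝ≥0∞)⁻¹ s
     ≤ (μH[1] : Measure ℂ) s := by
  rw [H_eq_iSup_pre]
  exact le_iSup (fun n : ℕ => OuterMeasure.mkMetric'.pre
    (fun s : Set ℂ => ediam s ^ (1 : ℝ)) (n : ℝ≥0∞)⁻¹ s) n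

theorem delta_le (N : ℕ) : ENNReal.ofReal (10 * (1 / (10 * ((N : ℝ) + 1)))) ≤ (N : ℝ≥0∞)⁻¹ := by
  rw [show 10 * (1 / (10 * ((N : ℝ) + 1))) = ((N : ℝ) + 1)⁻¹ by field_simp,
    ENNReal.ofReal_inv_of_pos (by positivity)]
  apply ENNReal.inv_le_inv.2
  rw [ENNReal.ofReal_add (by positivity) (by norm_num)]
  simp

theorem sum_le {ι : Type*} {l : Filter ι} (Kn : ι → Set ℂ)
    (A : Set ℂ) (t : Set ℂ) (r : ℂ → ℝ)
    (hd : ∀ x ∈ t, ∀ q : ℝ, q < 2 * r x →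
      ∀ᶠ n in l, ENNReal.ofReal q ≤ μH[1] (Kn n ∩ closedBall x (r x)))
    (hA : ∀ x ∈ t, closedBall x (r x) ⊆ A)
    (hdisj : t.PairwiseDisjoint fun x => closedBall x (r x))
    (c : ℝ≥0∞) (hc : ∃ᶠ n in l, μH[1] (Kn n ∩ A) ≤ c) :
    ∑' x : t, ENNReal.ofReal (2 * r x) ≤ c := by
  rw [ENNReal.tsum_eq_iSup_sum]
  refine iSup_le fun F => ?_
  have key : ∀ ε : ℝ, 0 < ε → ∑ x ∈ F, ENNReal.ofReal (2 * r x - ε) ≤ c := by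
    intro ε hε
    have h1 : ∀ᶠ n in l, ∀ x ∈ F, ENNReal.ofReal (2 * r x - ε) ≤
        μH[1] (Kn n ∩ closedBall (x : ℂ) (r x)) := by
      rw [Finset.eventually_all]
      intro x _
      exact hd x x.2 _ (by linarith)
    obtain ⟨n, hn1, hn2⟩ := (hc.and_eventually h1).exists
    refine le_trans (Finset.sum_le_sum hn2) (le_trans ?_ hn1)
    have h3 : ∀ x ∈ F, μH[1] (Kn n ∩ closedBall (x : ℂ) (r x)) =
      (μH[1] : Measure ℂ).restrict (Kn n) (closedBall (x : ℂ) (r x)) := by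
      intro x _
      rw [Measure.restrict_apply isClosed_closedBall.measurableSet, inter_comm]
    rw [Finset.sum_congr rfl h3, ← measure_biUnion_finset]
    · rw [Measure.restrict_apply (Finset.measurableSet_biUnion _
        fun x _ => isClosed_closedBall.measurableSet), inter_comm]
      gcongr
      exact iUnion₂_subset fun x _ => hA x x.2
    · intro x _ y _ hxy
      exact hdisj x.2 y.2 (fun h => hxy (Subtype.ext h))
    · intro x _
      exact isClosed_closedBall.measurableSet
  have hlim : Tendsto (fun ε : ℝ => ∑ x ∈ F, ENNReal.ofReal (2 * r x - ε)) (𝓝[>] 0)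
      (𝓝 (∑ x ∈ F, ENNReal.ofReal (2 * r x - 0))) := by
    apply tendsto_finsetSum
    intro x _
    apply Tendsto.mono_left _ nhdsWithin_le_nhds
    exact (ENNReal.continuous_ofReal.comp (by fun_prop : Continuous fun ε : ℝ => 2 * r x - ε)).tendsto 0
  simp only [sub_zero] at hlim
  refine le_of_tendsto hlim ?_
  filter_upwards [self_mem_nhdsWithin] with ε hε
  exact key ε hε

theorem lsc {ι : Type*} {l : Filter ι} (Kn : ι → Set ℂ)
    (K A : Set ℂ) (hK : MeasurableSet K) (hA : IsOpen A)
    (hd : ∀ x ∈ K, ∃ η : ℝ, 0 < η ∧ ∀ s, 0 < s → s < η → ∀ q : ℝ, q < 2 * s →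
      ∀ᶠ n in l, ENNReal.ofReal q ≤ μH[1] (Kn n ∩ closedBall x s))
    (c : ℝ≥0∞) (hc : ∃ᶠ n in l, μH[1] (Kn n ∩ A) ≤ c) : μH[1] (K ∩ A) ≤ c := by
  rcases eq_or_ne c ∞ with rfl | hctop
  · exact le_top
  have hd' : ∀ x, ∃ η : ℝ, 0 < η ∧ (x ∈ K ∩ A → (∀ s, 0 < s → s < η → ∀ q : ℝ, q < 2 * s →
      ∀ᶠ n in l, ENNReal.ofReal q ≤ μH[1] (Kn n ∩ closedBall x s)) ∧
      ∀ s, s < η → closedBall x s ⊆ A) := by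
    intro x
    by_cases hx : x ∈ K ∩ A
    · obtain ⟨η, hη, h⟩ := hd x hx.1
      obtain ⟨ε, hε, h'⟩ := Metric.isOpen_iff.1 hA x hx.2
      refine ⟨min η ε, lt_min hη hε, fun _ => ⟨fun s h0 h1 => h s h0 (h1.trans_le (min_le_left _ _)),
        fun s hs => (closedBall_subset_ball (hs.trans_le (min_le_right _ _))).trans h'⟩⟩
    · exact ⟨1, one_pos, fun h => absurd h hx⟩
  choose η hη hprop using hd'
  -- finiteness
  have hfin : μH[1] (K ∩ A) ≤ 5 * c := by
    rw [H_eq_iSup_pre]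
    refine iSup_le fun N => ?_
    set δ : ℝ := 1 / (10 * ((N : ℝ) + 1)) with hδ
    have hδ0 : 0 < δ := by positivity
    have hδN : ENNReal.ofReal (10 * δ) ≤ (N : ℝ≥0∞)⁻¹ := delta_le N
    obtain ⟨u, hut, hdisj, hcov⟩ := Vitali.exists_disjoint_subfamily_covering_enlargement_closedBall
      (K ∩ A) (fun x : ℂ => x) (fun x => min δ (η x / 2)) δ (fun x _ => min_le_left _ _) 5 (by norm_num)
    have hr0 : ∀ x, 0 < min δ (η x / 2) := fun x => lt_min hδ0 (half_pos (hη x))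
    have hrη : ∀ x, min δ (η x / 2) < η x := fun x =>
      (min_le_right _ _).trans_lt (half_lt_self (hη x))
    have hucount : u.Countable := by
      refine hdisj.countable_of_nonempty_interior fun x _ => ?_
      exact ⟨x, ball_subset_interior_closedBall (mem_ball_self (hr0 x))⟩
    have hsub : K ∩ A ⊆ ⋃ b ∈ u, closedBall b (5 * min δ (η b / 2)) := by
      intro x hx
      obtain ⟨b, hb, hb'⟩ := hcov x hx
      exact mem_biUnion hb (hb' (mem_closedBall_self (hr0 x).le))
    refine (measure_mono hsub).trans ((measure_biUnion_le _ hucount _).trans ?_)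
    have hs := sum_le Kn A u (fun x => min δ (η x / 2))
      (fun x hx => (hprop x (hut hx)).1 _ (hr0 x) (hrη x))
      (fun x hx => (hprop x (hut hx)).2 _ (hrη x)) hdisj c hc
    refine le_trans ?_ (mul_le_mul_right hs 5)
    rw [← ENNReal.tsum_mul_left]
    refine ENNReal.tsum_le_tsum fun x => ?_
    have e : ENNReal.ofReal (2 * (5 * min δ (η x / 2))) = 5 * ENNReal.ofReal (2 * min δ (η x / 2)) := by
      rw [show 2 * (5 * min δ (η x / 2)) = 5 * (2 * min δ (η x / 2)) by ring,
        ENNReal.ofReal_mul (by norm_num)]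
      norm_num
    rw [← e]
    refine pre_ball_le _ (le_trans (ENNReal.ofReal_le_ofReal ?_) hδN)
    have := min_le_left δ (η x / 2)
    linarith
  have hfin' : μH[1] (K ∩ A) < ∞ :=
    hfin.trans_lt (ENNReal.mul_lt_top (by norm_num) hctop.lt_top)
  haveI : IsFiniteMeasure ((μH[1] : Measure ℂ).restrict (K ∩ A)) := ⟨by simpa using hfin'⟩
  rw [H_eq_iSup_pre]
  refine iSup_le fun N => ?_
  set δ : ℝ := 1 / (10 * ((N : ℝ) + 1)) with hδ
  have hδ0 : 0 < δ := by positivity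
  have hδN : ENNReal.ofReal (10 * δ) ≤ (N : ℝ≥0∞)⁻¹ := delta_le N
  obtain ⟨t, r, htc, hts, hr, hnull, hdisj⟩ := Besicovitch.exists_disjoint_closedBall_covering_ae
    ((μH[1] : Measure ℂ).restrict (K ∩ A)) (fun _ => univ) (K ∩ A)
    (fun x _ ε hε => by simpa using hε) (fun x => min δ (η x))
    (fun x _ => lt_min hδ0 (hη x))
  have hm : MeasurableSet (⋃ x ∈ t, closedBall x (r x)) :=
    MeasurableSet.biUnion htc fun x _ => isClosed_closedBall.measurableSet
  have hnull' : (μH[1] : Measure ℂ) ((K ∩ A) \ ⋃ x ∈ t, closedBall x (r x)) = 0 := by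
    rw [Measure.restrict_apply ((hK.inter hA.measurableSet).diff hm)] at hnull
    rwa [inter_eq_left.2 diff_subset] at hnull
  have hsub : K ∩ A ⊆ ((K ∩ A) \ ⋃ x ∈ t, closedBall x (r x)) ∪ ⋃ x ∈ t, closedBall x (r x) := by
    rw [diff_union_self]; exact subset_union_left
  refine (measure_mono hsub).trans ((measure_union_le _ _).trans ?_)
  have h0 := (pre_le_H ((K ∩ A) \ ⋃ x ∈ t, closedBall x (r x)) N).trans hnull'.le
  rw [nonpos_iff_eq_zero.1 h0, zero_add]
  refine (measure_biUnion_le _ htc _).trans ?_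
  have hs := sum_le Kn A t r
    (fun x hx => (hprop x (hts hx)).1 _ (hr x hx).2.1 ((hr x hx).2.2.trans_le (min_le_right _ _)))
    (fun x hx => (hprop x (hts hx)).2 _ ((hr x hx).2.2.trans_le (min_le_right _ _))) hdisj c hc
  refine le_trans (ENNReal.tsum_le_tsum fun x => ?_) hs
  refine pre_ball_le _ (le_trans (ENNReal.ofReal_le_ofReal ?_) hδN)
  have := (hr x x.2).2.2.trans_le (min_le_left _ _)
  linarith

end Isop
end

section
open Set MeasureTheory Filter Topology Metric
open scoped ENNReal NNReal MeasureTheory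
namespace Isop

structure Dens (g : ℝ → ℝ) : Prop where
  cont : Continuous g
  pos : ∀ r, 0 < g r
  mono : ∀ r s, 0 ≤ r → r ≤ s → g r ≤ g s
  inf : Tendsto g atTop atTop

noncomputable def W (g : ℝ → ℝ) (z : ℂ) : ℝ≥0∞ := ENNReal.ofReal (g ‖z‖)
noncomputable def nu (g : ℝ → ℝ) : Measure ℂ := volume.withDensity (W g)
noncomputable def pw (g : ℝ → ℝ) : Measure ℂ := (μH[1] : Measure ℂ).withDensity (W g)
noncomputable def P (g : ℝ → ℝ) (U : Set ℂ) : ℝ≥0∞ := pw g (frontier U)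
noncomputable def ep (θ : ℝ) : ℂ := Complex.exp (θ * Complex.I)

lemma norm_ep (θ : ℝ) : ‖ep θ‖ = 1 := Complex.norm_exp_ofReal_mul_I θ

lemma ep_cont : Continuous ep := by unfold ep; fun_prop

variable {g : ℝ → ℝ}

lemma W_cont (hg : Dens g) : Continuous (W g) := by
  have := hg.cont
  unfold W
  exact ENNReal.continuous_ofReal.comp (this.comp continuous_norm)

lemma W_meas (hg : Dens g) : Measurable (W g) := (W_cont hg).measurable

lemma nu_apply (U : Set ℂ) : nu g U = ∫⁻ x in U, W g x := by
  unfold nu; exact withDensity_apply' _ _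

lemma pw_apply {U : Set ℂ} (hU : MeasurableSet U) : pw g U = ∫⁻ x in U, W g x ∂μH[1] := by
  unfold pw; exact withDensity_apply _ hU

lemma nu_polar (hg : Dens g) {U : Set ℂ} (hU : MeasurableSet U) :
    nu g U = ∫⁻ s in Ioi (0:ℝ), ENNReal.ofReal s * (ENNReal.ofReal (g s) *
      volume (Ioo (-Real.pi) Real.pi ∩ {θ : ℝ | (s:ℂ) * ep θ ∈ U})) := by
  rw [nu_apply, ← lintegral_indicator hU, ← Complex.lintegral_comp_polarCoord_symm]
  have hm : Measurable (fun p : ℝ × ℝ => ENNReal.ofReal p.1 *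
      (U.indicator (W g) (p.1 * ep p.2))) := by
    have h1 : Measurable (fun p : ℝ × ℝ => (p.1:ℂ) * ep p.2) := by
      have := ep_cont
      exact Continuous.measurable (by fun_prop)
    have := ((W_meas hg).indicator hU).comp h1
    have h2 : Measurable (fun p : ℝ × ℝ => ENNReal.ofReal p.1) := by fun_prop
    exact h2.mul this
  have e : polarCoord.target = Ioi (0:ℝ) ×ˢ Ioo (-Real.pi) Real.pi := rfl
  rw [e, Measure.volume_eq_prod, ← Measure.prod_restrict]
  have e2 : ∀ p : ℝ × ℝ, Complex.polarCoord.symm p = p.1 * ep p.2 := by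
    intro p
    rw [Complex.polarCoord_symm_apply, ep, Complex.exp_mul_I]
    simp
  simp only [e2, smul_eq_mul]
  rw [lintegral_prod _ hm.aemeasurable]
  apply setLIntegral_congr_fun measurableSet_Ioi
  intro s hs
  have hs' : (0:ℝ) < s := hs
  dsimp only
  have hmt : MeasurableSet {θ : ℝ | (s:ℂ) * ep θ ∈ U} := by
    have h1 : Measurable (fun θ : ℝ => (s:ℂ) * ep θ) := by
      have := ep_cont
      exact Continuous.measurable (by fun_prop)
    exact h1 hU
  have e3 : ∀ θ : ℝ, ENNReal.ofReal s * U.indicator (W g) (s * ep θ) =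
     ({θ : ℝ | (s:ℂ) * ep θ ∈ U}).indicator (fun _ => ENNReal.ofReal s * ENNReal.ofReal (g s)) θ := by
    intro θ
    by_cases h : (s:ℂ) * ep θ ∈ U
    · have h' : θ ∈ {θ : ℝ | (s:ℂ) * ep θ ∈ U} := h
      rw [indicator_of_mem h, indicator_of_mem h', W, norm_mul, norm_ep]
      simp [abs_of_pos hs']
    · have h' : θ ∉ {θ : ℝ | (s:ℂ) * ep θ ∈ U} := h
      rw [indicator_of_notMem h, indicator_of_notMem h', mul_zero]
  simp only [e3]
  rw [lintegral_indicator hmt, setLIntegral_const, Measure.restrict_apply hmt, mul_assoc, inter_comm]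

lemma g0_pos (hg : Dens g) : 0 < g 0 := hg.pos 0

lemma W_ge (hg : Dens g) {r : ℝ} (hr : 0 ≤ r) {z : ℂ} (hz : r ≤ ‖z‖) : ENNReal.ofReal (g r) ≤ W g z :=
  ENNReal.ofReal_le_ofReal (hg.mono _ _ hr hz)

lemma W_le (hg : Dens g) {r : ℝ} {z : ℂ} (hz : ‖z‖ ≤ r) : W g z ≤ ENNReal.ofReal (g r) :=
  ENNReal.ofReal_le_ofReal (hg.mono _ _ (norm_nonneg _) hz)

lemma pw_ge (hg : Dens g) {r : ℝ} (hr : 0 ≤ r) {A : Set ℂ} (hA : MeasurableSet A) (h : ∀ z ∈ A, r ≤ ‖z‖) :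
    ENNReal.ofReal (g r) * μH[1] A ≤ pw g A := by
  rw [pw_apply hA, ← setLIntegral_const]
  exact setLIntegral_mono' hA (fun z hz => W_ge hg hr (h z hz))

lemma pw_le (hg : Dens g) {r : ℝ} {A : Set ℂ} (hA : MeasurableSet A) (h : ∀ z ∈ A, ‖z‖ ≤ r) :
    pw g A ≤ ENNReal.ofReal (g r) * μH[1] A := by
  rw [pw_apply hA, ← setLIntegral_const]
  exact setLIntegral_mono' hA (fun z hz => W_le hg (h z hz))

lemma nu_ge (hg : Dens g) {r : ℝ} (hr : 0 ≤ r) {A : Set ℂ} (hA : MeasurableSet A) (h : ∀ z ∈ A, r ≤ ‖z‖) :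
    ENNReal.ofReal (g r) * volume A ≤ nu g A := by
  rw [nu_apply, ← setLIntegral_const]
  exact setLIntegral_mono' hA (fun z hz => W_ge hg hr (h z hz))

lemma nu_le (hg : Dens g) {r : ℝ} {A : Set ℂ} (hA : MeasurableSet A) (h : ∀ z ∈ A, ‖z‖ ≤ r) :
    nu g A ≤ ENNReal.ofReal (g r) * volume A := by
  rw [nu_apply, ← setLIntegral_const]
  exact setLIntegral_mono' hA (fun z hz => W_le hg (h z hz))

lemma H_le_pw (hg : Dens g) {A : Set ℂ} (hA : MeasurableSet A) :
    ENNReal.ofReal (g 0) * μH[1] A ≤ pw g A := pw_ge hg le_rfl hA (fun _ _ => norm_nonneg _)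

lemma H_fin (hg : Dens g) {A : Set ℂ} (hA : MeasurableSet A) (h : pw g A ≠ ∞) : μH[1] A ≠ ∞ := by
  intro h'
  have := H_le_pw hg hA
  rw [h', ENNReal.mul_top (by simpa using g0_pos hg)] at this
  exact h (top_le_iff.1 this)

lemma vol_ac : (nu g) ≪ volume := withDensity_absolutelyContinuous _ _

lemma null_of_H {A : Set ℂ} (h : μH[1] A ≠ ∞) : volume A = 0 := by
  have h2 : (μH[2] : Measure ℂ) A = 0 := by
    rcases Measure.hausdorffMeasure_zero_or_top (show (1:ℝ) < 2 by norm_num) A with h' | h'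
    · exact h'
    · exact absurd h' h
  have : (μH[Module.finrank ℝ ℂ] : Measure ℂ).IsAddHaarMeasure := inferInstance
  have e : (μH[Module.finrank ℝ ℂ] : Measure ℂ) = μH[2] := by simp
  have hac : (volume : Measure ℂ) ≪ (μH[Module.finrank ℝ ℂ] : Measure ℂ) :=
    Measure.absolutelyContinuous_isAddHaarMeasure _ _
  rw [e] at hac
  exact hac h2

lemma nu_null (hg : Dens g) {A : Set ℂ} (h : μH[1] A ≠ ∞) : nu g A = 0 := vol_ac (null_of_H h)

lemma nu_null' (hg : Dens g) {U : Set ℂ} (h : P g U ≠ ∞) : nu g (frontier U) = 0 :=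
  nu_null hg (H_fin hg isClosed_frontier.measurableSet h)

lemma nu_ball_lt (hg : Dens g) (R : ℝ) : nu g (ball 0 R) < ∞ := by
  refine (nu_le hg measurableSet_ball (r := R) (fun z hz => (mem_ball_zero_iff.1 hz).le)).trans_lt ?_
  exact ENNReal.mul_lt_top ENNReal.ofReal_lt_top measure_ball_lt_top

lemma nu_sphere (r : ℝ) : nu g (sphere (0:ℂ) r) = 0 := by
  apply vol_ac
  exact Measure.addHaar_sphere _ _ _

/-- rotations -/
lemma rot_isom (c : ℂ) (hc : ‖c‖ = 1) : Isometry (fun z : ℂ => c * z) := by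
  refine Isometry.of_dist_eq fun x y => ?_
  rw [dist_eq_norm, ← mul_sub, norm_mul, hc, one_mul, dist_eq_norm]

lemma rot_H (c : ℂ) (hc : ‖c‖ = 1) : MeasurePreserving (fun z : ℂ => c * z) μH[1] μH[1] := by
  have hc0 : c ≠ 0 := by intro h; simp [h] at hc
  refine ⟨(rot_isom c hc).continuous.measurable, ?_⟩
  rw [(rot_isom c hc).map_hausdorffMeasure (Or.inl zero_le_one)]
  have : range (fun z : ℂ => c * z) = univ := by
    refine range_eq_univ.2 fun y => ⟨c⁻¹ * y, by field_simp⟩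
  rw [this, Measure.restrict_univ]

lemma rot_vol (c : ℂ) (hc : ‖c‖ = 1) : MeasurePreserving (fun z : ℂ => c * z) volume volume := by
  have hc0 : c ≠ 0 := by intro h; simp [h] at hc
  refine ⟨(rot_isom c hc).continuous.measurable, ?_⟩
  have := Measure.isAddLeftInvariant_eq_smul (volume : Measure ℂ) (μH[Module.finrank ℝ ℂ] : Measure ℂ)
  rw [this, Measure.map_smul, (rot_isom c hc).map_hausdorffMeasure (Or.inl (by positivity))]
  have : range (fun z : ℂ => c * z) = univ := by
    refine range_eq_univ.2 fun y => ⟨c⁻¹ * y, by field_simp⟩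
  rw [this, Measure.restrict_univ]

lemma rot_nu (hg : Dens g) (c : ℂ) (hc : ‖c‖ = 1) : MeasurePreserving (fun z : ℂ => c * z) (nu g) (nu g) := by
  have h := rot_vol c hc
  refine ⟨h.measurable, ?_⟩
  ext A hA
  rw [Measure.map_apply h.measurable hA, nu_apply, nu_apply,
    ← h.setLIntegral_comp_preimage hA (W_meas hg)]
  simp [W, hc]

lemma rot_pw (hg : Dens g) (c : ℂ) (hc : ‖c‖ = 1) : MeasurePreserving (fun z : ℂ => c * z) (pw g) (pw g) := by
  have h := rot_H c hc
  refine ⟨h.measurable, ?_⟩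
  ext A hA
  rw [Measure.map_apply h.measurable hA, pw_apply hA, pw_apply (h.measurable hA),
    ← h.setLIntegral_comp_preimage hA (W_meas hg)]
  simp [W, hc]

def rot (α : ℝ) (U : Set ℂ) : Set ℂ := (fun z => ep α * z) ⁻¹' U

lemma rot_open (α : ℝ) {U : Set ℂ} (hU : IsOpen U) : IsOpen (rot α U) :=
  hU.preimage (by fun_prop)

lemma nu_rot (hg : Dens g) (α : ℝ) {U : Set ℂ} (hU : MeasurableSet U) : nu g (rot α U) = nu g U :=
  (rot_nu hg _ (norm_ep α)).measure_preimage hU.nullMeasurableSet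

lemma frontier_rot (α : ℝ) (U : Set ℂ) : frontier (rot α U) = rot α (frontier U) := by
  have : ep α ≠ 0 := by intro h; have := norm_ep α; simp [h] at this
  exact ((Homeomorph.mulLeft₀ _ this).preimage_frontier U).symm

lemma P_rot (hg : Dens g) (α : ℝ) (U : Set ℂ) : P g (rot α U) = P g U := by
  rw [P, frontier_rot]
  exact (rot_pw hg _ (norm_ep α)).measure_preimage isClosed_frontier.measurableSet.nullMeasurableSet

/-- submodularity -/
lemma submod (g : ℝ → ℝ) {A B : Set ℂ} (hA : IsOpen A) (hB : IsOpen B) :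
    P g (A ∪ B) + P g (A ∩ B) ≤ P g A + P g B := by
  unfold P
  have h1 : frontier (A ∪ B) ∪ frontier (A ∩ B) ⊆ frontier A ∪ frontier B := by
    apply union_subset
    · exact (frontier_union_subset A B).trans (union_subset_union inter_subset_left inter_subset_right)
    · exact (frontier_inter_subset A B).trans (union_subset_union inter_subset_left inter_subset_right)
  have h2 : frontier (A ∪ B) ∩ frontier (A ∩ B) ⊆ frontier A ∩ frontier B := by
    rintro x ⟨h1, h2⟩
    rw [(hA.union hB).frontier_eq] at h1
    rw [(hA.inter hB).frontier_eq] at h2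
    rw [hA.frontier_eq, hB.frontier_eq]
    exact ⟨⟨closure_mono inter_subset_left h2.1, fun h => h1.2 (Or.inl h)⟩,
      ⟨closure_mono inter_subset_right h2.1, fun h => h1.2 (Or.inr h)⟩⟩
  have m : ∀ s : Set ℂ, MeasurableSet (frontier s) := fun s => isClosed_frontier.measurableSet
  rw [← measure_union_add_inter _ (m _), ← measure_union_add_inter (frontier A) (m _)]
  exact add_le_add (measure_mono h1) (measure_mono h2)

end Isop
end

section
open Set MeasureTheory Filter Topology Metric
open scoped ENNReal NNReal MeasureTheory Pointwise
namespace Isop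
variable {g : ℝ → ℝ}

lemma ep_add (a b : ℝ) : ep (a + b) = ep a * ep b := by
  unfold ep; rw [← Complex.exp_add]; push_cast; ring_nf

lemma norm_ep_sub (a b : ℝ) : ‖ep a - ep b‖ = 2 * |Real.sin ((a - b) / 2)| := by
  have : ep a - ep b = ep b * (Complex.exp (Complex.I * ((a - b : ℝ) : ℂ)) - 1) := by
    have h : ep a = ep b * ep (a - b) := by rw [← ep_add]; ring_nf
    rw [h, mul_sub, mul_one, ep, ep, mul_comm Complex.I]
  rw [this, norm_mul, norm_ep, one_mul, Complex.norm_exp_I_mul_ofReal_sub_one]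
  simp

lemma ep_lip (x : ℂ) : LipschitzWith ‖x‖₊ (fun θ : ℝ => x * ep θ) := by
  refine LipschitzWith.of_dist_le_mul fun a b => ?_
  rw [dist_eq_norm, ← mul_sub, norm_mul, norm_ep_sub, Real.dist_eq]
  simp only [coe_nnnorm]
  gcongr
  have := Real.abs_sin_le_abs (x := (a-b)/2)
  rw [abs_div] at this
  norm_num at this
  linarith

lemma H_arc_le (x : ℂ) (Θ : Set ℝ) :
    μH[1] ((fun θ : ℝ => x * ep θ) '' Θ) ≤ ENNReal.ofReal ‖x‖ * volume Θ := by
  have := (ep_lip x).hausdorffMeasure_image_le (d := 1) zero_le_one Θ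
  rw [hausdorffMeasure_real] at this
  simpa [ENNReal.ofReal] using this

lemma ep_arg {z : ℂ} (hz : ‖z‖ = 1) : ep z.arg = z := by
  have := Complex.norm_mul_exp_arg_mul_I z
  rwa [hz, Complex.ofReal_one, one_mul] at this

lemma arg_ep {θ : ℝ} (h : θ ∈ Ioc (-Real.pi) Real.pi) : (ep θ).arg = θ := by
  unfold ep
  rw [Complex.arg_exp_mul_I, toIocMod_eq_self]
  rw [show -Real.pi + 2 * Real.pi = Real.pi by ring]; exact h

lemma vol_half {a : ℝ} {Θ : Set ℝ} (h0 : Θ ⊆ Ioc (-Real.pi) Real.pi) (hΘ : Θ ⊆ Icc a (a + Real.pi)) :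
    volume Θ ≤ ENNReal.ofReal (Real.pi / 2) * μH[1] (ep '' Θ) := by
  have hl : LipschitzOnWith (Real.toNNReal (Real.pi / 2)) Complex.arg (ep '' Θ) := by
    refine LipschitzOnWith.of_dist_le_mul ?_
    rintro _ ⟨x, hx, rfl⟩ _ ⟨y, hy, rfl⟩
    rw [arg_ep (h0 hx), arg_ep (h0 hy), dist_eq_norm (ep x), norm_ep_sub, Real.dist_eq,
      Real.coe_toNNReal _ (by positivity)]
    have hpi := Real.pi_pos
    have h1 : |x - y| ≤ Real.pi := by
      rw [abs_le]; have := hΘ hx; have := hΘ hy; simp only [mem_Icc] at *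
      constructor <;> linarith
    have h2 : |Real.sin ((x - y) / 2)| = Real.sin (|x - y| / 2) := by
      rcases abs_cases (x - y) with ⟨h, h'⟩ | ⟨h, h'⟩
      · rw [h]; rw [h] at h1
        exact abs_of_nonneg (Real.sin_nonneg_of_nonneg_of_le_pi (by linarith) (by linarith))
      · rw [h]; rw [h] at h1
        rw [neg_div, Real.sin_neg, abs_of_nonpos]
        exact Real.sin_nonpos_of_nonpos_of_neg_pi_le (by linarith) (by linarith)
    have h3 := Real.mul_le_sin (x := |x - y| / 2) (by positivity) (by linarith)
    rw [h2]
    have h4 : 2 / Real.pi * (|x - y| / 2) * (Real.pi / 2 * 2) = |x - y| := by field_simp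
    nlinarith
  have := hl.hausdorffMeasure_image_le (d := 1) zero_le_one
  rw [hausdorffMeasure_real, image_image] at this
  have e : (fun x => (ep x).arg) '' Θ = Θ := by
    have : EqOn (fun x => (ep x).arg) id Θ := fun x hx => arg_ep (h0 hx)
    rw [this.image_eq, image_id]
  rw [e] at this
  simpa [ENNReal.ofReal] using this

lemma vol_le_arc {Θ : Set ℝ} (hΘ : Θ ⊆ Ioo (-Real.pi) Real.pi) {r : ℝ} (hr : 0 < r) :
    ENNReal.ofReal r * volume Θ ≤ ENNReal.ofReal Real.pi * μH[1] ((fun θ : ℝ => (r:ℂ) * ep θ) '' Θ) := by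
  have hpi := Real.pi_pos
  have h1 := vol_half (a := -Real.pi) (Θ := Θ ∩ Iic 0) (fun x hx => ⟨(hΘ hx.1).1, (hΘ hx.1).2.le⟩)
    (fun x hx => ⟨(hΘ hx.1).1.le, by have := hx.2; simp at this ⊢; linarith⟩)
  have h2 := vol_half (a := 0) (Θ := Θ ∩ Ioi 0) (fun x hx => ⟨(hΘ hx.1).1, (hΘ hx.1).2.le⟩)
    (fun x hx => ⟨le_of_lt hx.2, by have := (hΘ hx.1).2; linarith⟩)
  have h3 : volume Θ ≤ ENNReal.ofReal Real.pi * μH[1] (ep '' Θ) := by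
    calc volume Θ ≤ volume (Θ ∩ Iic 0) + volume (Θ ∩ Ioi 0) := by
          refine (measure_mono ?_).trans (measure_union_le _ _)
          intro x hx
          rcases le_or_gt x 0 with h | h
          · exact Or.inl ⟨hx, h⟩
          · exact Or.inr ⟨hx, h⟩
      _ ≤ ENNReal.ofReal (Real.pi / 2) * μH[1] (ep '' Θ) + ENNReal.ofReal (Real.pi / 2) * μH[1] (ep '' Θ) := by
          refine add_le_add (h1.trans ?_) (h2.trans ?_) <;> gcongr <;> exact inter_subset_left
      _ = _ := by
          rw [← add_mul, ← ENNReal.ofReal_add (by positivity) (by positivity)]; ring_nf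
  have e : (fun θ : ℝ => (r:ℂ) * ep θ) '' Θ = r • (ep '' Θ) := by
    rw [← image_smul, image_image]; simp
  rw [e, Measure.hausdorffMeasure_smul₀ zero_le_one hr.ne']
  simp only [NNReal.rpow_one]
  rw [ENNReal.smul_def, smul_eq_mul]
  have : ((‖r‖₊ : ℝ≥0) : ℝ≥0∞) = ENNReal.ofReal r := by
    rw [← Real.norm_of_nonneg hr.le, ofReal_norm]; simp [enorm]
  rw [this]
  calc _ ≤ ENNReal.ofReal r * (ENNReal.ofReal Real.pi * μH[1] (ep '' Θ)) := by gcongr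
    _ = _ := by ring

lemma sphere_cover (x : ℂ) : sphere (0:ℂ) ‖x‖ \ {-x} ⊆ (fun θ : ℝ => x * ep θ) '' Ioo (-Real.pi) Real.pi := by
  rintro y ⟨hy, hyx⟩
  have hy' : ‖y‖ = ‖x‖ := by simpa using hy
  by_cases hx : x = 0
  · subst hx
    simp at hy'
    simp [hy'] at hyx
  have hx' : ‖x‖ ≠ 0 := by simpa using hx
  have hn : ‖y / x‖ = 1 := by rw [norm_div, hy', div_self hx']
  refine ⟨(y / x).arg, ⟨Complex.neg_pi_lt_arg _, lt_of_le_of_ne (Complex.arg_le_pi _) ?_⟩, ?_⟩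
  · intro h
    have := ep_arg hn
    rw [h, ep, Complex.exp_pi_mul_I] at this
    apply hyx
    rw [eq_div_iff hx] at this
    simp [← this]
  · dsimp only
    rw [ep_arg hn]; field_simp

lemma cover_sphere (x : ℂ) (Θ : Set ℝ): (fun θ : ℝ => x * ep θ) '' Θ ⊆ sphere (0:ℂ) ‖x‖ := by
  rintro _ ⟨θ, -, rfl⟩
  simp [norm_ep]

lemma H_singleton (x : ℂ) : (μH[1] : Measure ℂ) {x} = 0 := by
  have := Measure.nullSingletonClass_hausdorff (X := ℂ) (d := 1) one_pos
  exact measure_singleton x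

lemma H_sphere_sub (x : ℂ) (A : Set ℂ) : μH[1] (sphere (0:ℂ) ‖x‖ ∩ A) ≤
    ENNReal.ofReal ‖x‖ * volume (Ioo (-Real.pi) Real.pi ∩ {θ | x * ep θ ∈ A}) := by
  refine le_trans ?_ (H_arc_le x _)
  have : sphere (0:ℂ) ‖x‖ ∩ A ⊆ ((fun θ : ℝ => x * ep θ) '' (Ioo (-Real.pi) Real.pi ∩ {θ | x * ep θ ∈ A})) ∪ {-x} := by
    rintro y ⟨hy, hyA⟩
    by_cases h : y = -x
    · exact Or.inr h
    · obtain ⟨θ, h1, rfl⟩ := sphere_cover x ⟨hy, h⟩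
      exact Or.inl ⟨θ, ⟨h1, hyA⟩, rfl⟩
  refine (measure_mono this).trans ((measure_union_le _ _).trans ?_)
  rw [H_singleton, add_zero]

noncomputable def c1 : ℝ≥0∞ := μH[1] (sphere (0:ℂ) 1)

lemma c1_fin : c1 ≠ ∞ := by
  have := H_sphere_sub 1 univ
  simp only [norm_one, inter_univ] at this
  refine ne_top_of_le_ne_top ?_ this
  refine ENNReal.mul_ne_top (by simp) ?_
  refine ne_top_of_le_ne_top ?_ (measure_mono inter_subset_left)
  simp

lemma c1_pos : 0 < c1 := by
  have := mult1 (u := Complex.re) (E := sphere (0:ℂ) 1) (S := Icc (-1) 1) (LipschitzWith.of_dist_le_mul fun x y => by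
    rw [Real.dist_eq, dist_eq_norm, ← Complex.sub_re]; simpa using Complex.abs_re_le_norm (x - y)) (by
    intro t ht
    refine ⟨ep (Real.arccos t), by simp [norm_ep], ?_⟩
    unfold ep
    rw [Complex.exp_ofReal_mul_I_re, Real.cos_arccos ht.1 ht.2])
  refine lt_of_lt_of_le ?_ this
  simp

lemma H_sphere {r : ℝ} (hr : 0 < r) : μH[1] (sphere (0:ℂ) r) = ENNReal.ofReal r * c1 := by
  have e : sphere (0:ℂ) r = r • sphere (0:ℂ) 1 := by
    rw [smul_sphere' hr.ne']; simp [abs_of_pos hr]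
  rw [e, Measure.hausdorffMeasure_smul₀ zero_le_one hr.ne']
  simp only [NNReal.rpow_one]
  rw [ENNReal.smul_def, smul_eq_mul]
  have : ((‖r‖₊ : ℝ≥0) : ℝ≥0∞) = ENNReal.ofReal r := by
    rw [← Real.norm_of_nonneg hr.le, ofReal_norm]; simp [enorm]
  rw [this, c1]

lemma sphere_preconn (x : ℂ) (r : ℝ) : IsPreconnected (sphere x r) :=
  isPreconnected_sphere (by rw [Complex.rank_real_complex]; norm_num) x r

end Isop
end

section
open Set MeasureTheory Filter Topology Metric
open scoped ENNReal NNReal MeasureTheory Pointwise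
namespace Isop
variable {g : ℝ → ℝ}

lemma preconn_frontier {t s : Set ℂ} (ht : IsPreconnected t) (h1 : (t ∩ s).Nonempty)
    (h2 : (t ∩ sᶜ).Nonempty) : (t ∩ frontier s).Nonempty := by
  by_contra hne
  rw [not_nonempty_iff_eq_empty] at hne
  have hcov : t ⊆ interior s ∪ (closure s)ᶜ := by
    intro x hx
    by_cases h : x ∈ interior s
    · exact Or.inl h
    · right
      intro h'
      have : x ∈ t ∩ frontier s := ⟨hx, h', h⟩
      rw [hne] at this; exact this
  obtain ⟨a, ha, has⟩ := h1
  obtain ⟨b, hb, hbs⟩ := h2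
  obtain ⟨c, -, hc1, hc2⟩ := ht _ _ isOpen_interior isClosed_closure.isOpen_compl hcov
    ⟨a, ha, (hcov ha).resolve_right fun h => h (subset_closure has)⟩
    ⟨b, hb, (hcov hb).resolve_left fun h => hbs (interior_subset h)⟩
  exact hc2 (interior_subset_closure hc1)

lemma proj_lip {r : ℝ} (hr : 0 < r) :
    LipschitzOnWith 1 (fun z : ℂ => ((r / ‖z‖ : ℝ) : ℂ) * z) {z | r ≤ ‖z‖} := by
  refine LipschitzOnWith.of_dist_le_mul ?_
  intro z hz w hw
  simp only [mem_ofPred_eq] at hz hw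
  rw [dist_eq_norm, dist_eq_norm, NNReal.coe_one, one_mul]
  refine le_of_sq_le_sq ?_ (norm_nonneg _)
  have ha : 0 < ‖z‖ := hr.trans_le hz
  have hb : 0 < ‖w‖ := hr.trans_le hw
  have e1 : ∀ u v : ℂ, ‖u - v‖ ^ 2 = ‖u‖ ^ 2 + ‖v‖ ^ 2 - 2 * (u.re * v.re + u.im * v.im) := by
    intro u v
    rw [← Complex.normSq_eq_norm_sq, ← Complex.normSq_eq_norm_sq, ← Complex.normSq_eq_norm_sq]
    simp [Complex.normSq_apply]; ring
  have hc : z.re * w.re + z.im * w.im ≤ ‖z‖ * ‖w‖ := by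
    have := e1 z w
    have h2 : (‖z‖ - ‖w‖)^2 ≤ ‖z - w‖ ^ 2 := by
      rw [← sq_abs]
      exact pow_le_pow_left₀ (abs_nonneg _) (abs_norm_sub_norm_le z w) 2
    nlinarith
  rw [e1, e1]
  have n1 : ‖((r / ‖z‖ : ℝ) : ℂ) * z‖ = r := by
    rw [norm_mul, Complex.norm_real, Real.norm_of_nonneg (by positivity)]; field_simp
  have n2 : ‖((r / ‖w‖ : ℝ) : ℂ) * w‖ = r := by
    rw [norm_mul, Complex.norm_real, Real.norm_of_nonneg (by positivity)]; field_simp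
  rw [n1, n2]
  simp only [Complex.re_ofReal_mul, Complex.im_ofReal_mul]
  set c := z.re * w.re + z.im * w.im with hcd
  have e3 : r / ‖z‖ * z.re * (r / ‖w‖ * w.re) + r / ‖z‖ * z.im * (r / ‖w‖ * w.im) = r^2 / (‖z‖ * ‖w‖) * c := by
    rw [hcd]; field_simp
  rw [e3]
  have hk : r^2 / (‖z‖ * ‖w‖) ≤ 1 := by
    rw [div_le_one (by positivity)]; nlinarith
  have hk2 : r^2 / (‖z‖ * ‖w‖) * (‖z‖ * ‖w‖) = r^2 := by field_simp
  nlinarith [mul_le_mul_of_nonneg_right hk (sub_nonneg.2 hc), sq_nonneg (‖z‖ - ‖w‖)]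

lemma ray_null (hg : Dens g) {U : Set ℂ} (hU : IsOpen U) (hf : nu g U ≠ ∞) {r : ℝ} (hr : 0 < r) :
    volume {θ ∈ Ioo (-Real.pi) Real.pi | ∀ s, r ≤ s → (s:ℂ) * ep θ ∈ U} = 0 := by
  set N := {θ ∈ Ioo (-Real.pi) Real.pi | ∀ s, r ≤ s → (s:ℂ) * ep θ ∈ U} with hN
  by_contra hne
  apply hf
  rw [nu_polar hg hU.measurableSet, eq_top_iff]
  have h1 : ∫⁻ s in Ioi r, (ENNReal.ofReal r * (ENNReal.ofReal (g 0) * volume N)) = ∞ := by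
    rw [setLIntegral_const, Real.volume_Ioi, ENNReal.mul_top]
    have := g0_pos hg
    simp [hr, this, hne]
  rw [← h1]
  refine (setLIntegral_mono' measurableSet_Ioi ?_).trans
    (lintegral_mono_set (Ioi_subset_Ioi hr.le))
  intro s hs
  have hs' : r < s := hs
  gcongr
  · exact hg.mono _ _ le_rfl (by linarith)
  · intro θ hθ
    exact ⟨hθ.1, hθ.2 s hs'.le⟩

lemma H_proj (hg : Dens g) {U : Set ℂ} (hU : IsOpen U) (hf : nu g U ≠ ∞) {r : ℝ} (hr : 0 < r) :
    μH[1] (sphere (0:ℂ) r ∩ closure U) ≤ μH[1] (frontier U \ ball 0 r) := by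
  set N := {θ ∈ Ioo (-Real.pi) Real.pi | ∀ s, r ≤ s → (s:ℂ) * ep θ ∈ U} with hN
  have hsub : sphere (0:ℂ) r ∩ closure U ⊆ ((fun z : ℂ => ((r / ‖z‖ : ℝ) : ℂ) * z) '' (frontier U \ ball 0 r))
      ∪ ((fun θ : ℝ => (r:ℂ) * ep θ) '' N ∪ {-(r:ℂ)}) := by
    rintro x ⟨hx, hxU⟩
    have hxr : ‖x‖ = r := by simpa using hx
    have hpos : ∀ s, r ≤ s → 0 < s := fun s hs => hr.trans_le hs
    by_cases hxf : x ∈ frontier U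
    · left
      refine ⟨x, ⟨hxf, by simp [hxr]⟩, ?_⟩
      simp [hxr, hr.ne']
    have hxU' : x ∈ U := by
      by_contra h
      exact hxf (by rw [hU.frontier_eq]; exact ⟨hxU, h⟩)
    by_cases hxn : x = -(r:ℂ)
    · right; right; exact hxn
    have hnr : ‖(r:ℂ)‖ = r := by simp [abs_of_pos hr]
    obtain ⟨θ, hθ, rfl⟩ := sphere_cover (r:ℂ) ⟨by rw [hnr]; exact hx, hxn⟩
    by_cases hN' : ∀ s, r ≤ s → (s:ℂ) * ep θ ∈ U
    · right; left; exact ⟨θ, ⟨hθ, hN'⟩, rfl⟩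
    push Not at hN'
    obtain ⟨s, hs, hsU⟩ := hN'
    left
    have hpc : IsPreconnected ((fun t : ℝ => (t:ℂ) * ep θ) '' Icc r s) :=
      isPreconnected_Icc.image _ (by fun_prop)
    obtain ⟨_, ⟨t, ht, rfl⟩, htf⟩ := preconn_frontier (s := U) hpc
      ⟨_, ⟨r, ⟨le_rfl, hs⟩, rfl⟩, hxU'⟩ ⟨_, ⟨s, ⟨hs, le_rfl⟩, rfl⟩, hsU⟩
    have ht0 := hpos t ht.1
    have hnt : ‖(t:ℂ) * ep θ‖ = t := by simp [norm_ep, abs_of_pos ht0]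
    refine ⟨_, ⟨htf, by simp only [mem_ball_zero_iff, hnt]; exact not_lt.2 ht.1⟩, ?_⟩
    dsimp only
    rw [hnt, ← mul_assoc]
    congr 1
    rw [← Complex.ofReal_mul]
    congr 1
    field_simp
  refine (measure_mono hsub).trans ((measure_union_le _ _).trans ?_)
  have h1 : μH[1] ((fun θ : ℝ => (r:ℂ) * ep θ) '' N ∪ {-(r:ℂ)}) = 0 := by
    rw [← nonpos_iff_eq_zero]
    refine (measure_union_le _ _).trans ?_
    rw [H_singleton, add_zero]
    refine (H_arc_le _ _).trans ?_
    rw [ray_null hg hU hf hr, mul_zero]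
  rw [h1, add_zero]
  have := ((proj_lip hr).mono (s := frontier U \ ball 0 r) (by
    intro z hz; simpa using hz.2)).hausdorffMeasure_image_le (d := 1) zero_le_one
  simpa using this

lemma pw_proj (hg : Dens g) {U : Set ℂ} (hU : IsOpen U) (hf : nu g U ≠ ∞) {r : ℝ} (hr : 0 < r) :
    ENNReal.ofReal (g r) * μH[1] (sphere (0:ℂ) r ∩ closure U) ≤ pw g (frontier U \ ball 0 r) := by
  refine (mul_le_mul_right (H_proj hg hU hf hr) _).trans ?_
  exact pw_ge hg hr.le (isClosed_frontier.measurableSet.diff measurableSet_ball) (fun z hz => by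
    simpa using hz.2)

lemma slice_le (hg : Dens g) {U : Set ℂ} (hU : IsOpen U) (hf : nu g U ≠ ∞) {r : ℝ} (hr : 0 < r) :
    ENNReal.ofReal (g r) * μH[1] (sphere (0:ℂ) r ∩ U) ≤ P g U := by
  refine le_trans ?_ ((pw_proj hg hU hf hr).trans (measure_mono sdiff_subset))
  gcongr
  exact subset_closure

lemma P_empty : P g ∅ = 0 := by simp [P]

lemma P_trunc (hg : Dens g) {U : Set ℂ} (hU : IsOpen U) (hf : nu g U ≠ ∞) (r : ℝ) :
    P g (U ∩ ball 0 r) ≤ P g U := by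
  rcases le_or_gt r 0 with hr | hr
  · rw [ball_eq_empty.2 hr]; simp [P_empty]
  have hsub : frontier (U ∩ ball 0 r) ⊆ (frontier U ∩ ball 0 r) ∪ (sphere (0:ℂ) r ∩ closure U) := by
    intro x hx
    rcases frontier_inter_subset _ _ hx with h | h
    · rw [closure_ball _ hr.ne'] at h
      rcases eq_or_lt_of_le (mem_closedBall_zero_iff.1 h.2) with h' | h'
      · right; exact ⟨by simpa using h', frontier_subset_closure h.1⟩
      · left; exact ⟨h.1, by simpa using h'⟩
    · right
      rw [frontier_ball _ hr.ne'] at h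
      exact ⟨h.2, h.1⟩
  unfold P
  calc _ ≤ pw g (frontier U ∩ ball 0 r) + pw g (sphere (0:ℂ) r ∩ closure U) :=
        (measure_mono hsub).trans (measure_union_le _ _)
    _ ≤ pw g (frontier U ∩ ball 0 r) + pw g (frontier U \ ball 0 r) := by
        refine add_le_add le_rfl ?_
        refine le_trans ?_ (pw_proj hg hU hf hr)
        exact pw_le hg (isClosed_sphere.inter isClosed_closure).measurableSet (fun z hz => by
          have := hz.1; simp at this; exact this.le)
    _ = _ := measure_inter_add_sdiff _ measurableSet_ball

lemma cont_trunc (hg : Dens g) {U : Set ℂ} (hU : MeasurableSet U) :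
    Continuous (fun r : ℝ => nu g (U ∩ ball 0 r)) := by
  rw [continuous_iff_continuousAt]
  intro r0
  refine tendsto_measure_of_ae_tendsto_indicator (𝓝 r0) (hU.inter measurableSet_ball)
    (fun r => hU.inter measurableSet_ball) (B := ball 0 (r0 + 1)) measurableSet_ball
    (nu_ball_lt hg _).ne ?_ ?_
  · filter_upwards [Iio_mem_nhds (show r0 < r0 + 1 by linarith)] with r hr
    exact inter_subset_right.trans (ball_subset_ball (le_of_lt hr))
  · have : ∀ᵐ x ∂(nu g), x ∉ sphere (0:ℂ) r0 := measure_eq_zero_iff_ae_notMem.1 (nu_sphere r0)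
    filter_upwards [this] with x hx
    have hx' : ‖x‖ ≠ r0 := by simpa using hx
    rcases lt_or_gt_of_ne hx' with h | h
    · filter_upwards [Ioi_mem_nhds h] with r hr
      have hr' : ‖x‖ < r := hr
      simp [h, hr']
    · filter_upwards [Iio_mem_nhds h] with r hr
      have hr' : r < ‖x‖ := hr
      simp [not_lt.2 h.le, not_lt.2 hr'.le]

lemma exists_trunc_vol (hg : Dens g) {U : Set ℂ} (hU : MeasurableSet U) {v : ℝ≥0∞} (hv : v < nu g U) :
    ∃ r, nu g (U ∩ ball 0 r) = v := by
  have hc := cont_trunc hg hU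
  have hlim : Tendsto (fun n : ℕ => nu g (U ∩ ball 0 (n:ℝ))) atTop (𝓝 (nu g U)) := by
    have := tendsto_measure_iUnion_atTop (μ := nu g) (s := fun n : ℕ => U ∩ ball (0:ℂ) (n:ℝ)) (by
      intro a b hab
      exact inter_subset_inter_right _ (ball_subset_ball (by exact_mod_cast hab)))
    rwa [← inter_iUnion, iUnion_ball_nat, inter_univ] at this
  obtain ⟨n, hn⟩ := (hlim.eventually (lt_mem_nhds hv)).exists
  exact mem_range_of_exists_le_of_exists_ge hc ⟨0, by simp⟩ ⟨n, hn.le⟩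

lemma exists_trunc (hg : Dens g) {U : Set ℂ} (hU : IsOpen U) (hf : nu g U ≠ ∞) {v : ℝ≥0∞} (hv : v ≤ nu g U) :
    ∃ U' ⊆ U, IsOpen U' ∧ nu g U' = v ∧ P g U' ≤ P g U := by
  rcases eq_or_lt_of_le hv with h | h
  · exact ⟨U, Subset.rfl, hU, h.symm, le_rfl⟩
  · obtain ⟨r, hr⟩ := exists_trunc_vol hg hU.measurableSet h
    exact ⟨_, inter_subset_left, hU.inter isOpen_ball, hr, P_trunc hg hU hf r⟩

lemma nu_univ (hg : Dens g) : nu g univ = ∞ := by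
  have := nu_ge hg le_rfl MeasurableSet.univ (fun z _ => norm_nonneg z)
  rw [measure_univ_of_isAddLeftInvariant, ENNReal.mul_top (by simpa using g0_pos hg)] at this
  exact top_le_iff.1 this

lemma exists_ball (hg : Dens g) {v : ℝ≥0∞} (hv : v ≠ ∞) : ∃ r, nu g (ball 0 r) = v := by
  have := exists_trunc_vol hg MeasurableSet.univ (v := v) (by rw [nu_univ hg]; exact hv.lt_top)
  simpa using this

lemma tail (hg : Dens g) {U : Set ℂ} (hU : IsOpen U) (hf : nu g U ≠ ∞) {R : ℝ} (hR : 0 < R)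
    (hP : P g U < ENNReal.ofReal (g R) * (ENNReal.ofReal R * c1)) :
    ENNReal.ofReal (g R) * nu g (U \ ball 0 R) ≤ ENNReal.ofReal Real.pi * P g U * P g U := by
  set S : Set ℝ := norm '' (frontier U \ ball 0 R) with hS
  have hvS : ENNReal.ofReal (g R) * volume S ≤ P g U := by
    refine (mul_le_mul_right (mult1 (u := norm) lipschitzWith_one_norm (E := frontier U \ ball 0 R) Subset.rfl) _).trans ?_
    refine (pw_ge hg hR.le (isClosed_frontier.measurableSet.diff measurableSet_ball) (fun z hz => by
      simpa using hz.2)).trans (measure_mono sdiff_subset)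
  rw [nu_polar hg (hU.measurableSet.diff measurableSet_ball)]
  have hkey : ∀ s : ℝ, 0 < s → ENNReal.ofReal s * (ENNReal.ofReal (g s) *
      volume (Ioo (-Real.pi) Real.pi ∩ {θ : ℝ | (s:ℂ) * ep θ ∈ U \ ball 0 R})) ≤
      (toMeasurable volume S).indicator (fun _ => ENNReal.ofReal Real.pi * P g U) s := by
    intro s hs
    have hns : ∀ θ, ‖(s:ℂ) * ep θ‖ = s := fun θ => by simp [norm_ep, abs_of_pos hs]
    rcases lt_or_ge s R with h | h
    · have : {θ : ℝ | (s:ℂ) * ep θ ∈ U \ ball 0 R} = ∅ := by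
        ext θ
        simp only [mem_ofPred_eq, mem_empty_iff_false, iff_false]
        rintro ⟨-, h2⟩
        rw [mem_ball_zero_iff, hns] at h2
        exact h2 h
      rw [this]; simp
    by_cases hsS : s ∈ S
    · rw [indicator_of_mem (subset_toMeasurable _ _ hsS)]
      have h1 := vol_le_arc (Θ := Ioo (-Real.pi) Real.pi ∩ {θ : ℝ | (s:ℂ) * ep θ ∈ U}) inter_subset_left hs
      have h2 : (fun θ : ℝ => (s:ℂ) * ep θ) '' (Ioo (-Real.pi) Real.pi ∩ {θ : ℝ | (s:ℂ) * ep θ ∈ U}) ⊆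
          sphere (0:ℂ) s ∩ U := by
        rintro _ ⟨θ, hθ, rfl⟩
        exact ⟨by rw [mem_sphere_zero_iff_norm, hns], hθ.2⟩
      calc _ = ENNReal.ofReal (g s) * (ENNReal.ofReal s * volume (Ioo (-Real.pi) Real.pi ∩ {θ : ℝ | (s:ℂ) * ep θ ∈ U \ ball 0 R})) := by ring
        _ ≤ ENNReal.ofReal (g s) * (ENNReal.ofReal s * volume (Ioo (-Real.pi) Real.pi ∩ {θ : ℝ | (s:ℂ) * ep θ ∈ U})) := by
          gcongr
          exact fun h h' => h'.1
        _ ≤ ENNReal.ofReal (g s) * (ENNReal.ofReal Real.pi * μH[1] (sphere (0:ℂ) s ∩ U)) := by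
          gcongr ENNReal.ofReal (g s) * ?_
          exact h1.trans (by gcongr)
        _ = ENNReal.ofReal Real.pi * (ENNReal.ofReal (g s) * μH[1] (sphere (0:ℂ) s ∩ U)) := by ring
        _ ≤ _ := by gcongr; exact slice_le hg hU hf hs
    · have hdis : sphere (0:ℂ) s ∩ U = ∅ := by
        by_contra hne
        rw [← ne_eq, ← nonempty_iff_ne_empty] at hne
        have hall : sphere (0:ℂ) s ⊆ U := by
          by_contra hns'
          rw [not_subset] at hns'
          obtain ⟨z, hz1, hz2⟩ := hns'
          obtain ⟨y, hy1, hy2⟩ := preconn_frontier (sphere_preconn 0 s) hne ⟨z, hz1, hz2⟩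
          have hy' : ‖y‖ = s := by simpa using hy1
          exact hsS ⟨y, ⟨hy2, by simp [hy', h]⟩, hy'⟩
        have h3 := slice_le hg hU hf hs
        rw [inter_eq_left.2 hall, H_sphere hs] at h3
        have h4 : ENNReal.ofReal (g R) * (ENNReal.ofReal R * c1) ≤ ENNReal.ofReal (g s) * (ENNReal.ofReal s * c1) := by
          gcongr
          exact hg.mono _ _ hR.le h
        exact absurd (h4.trans h3) (not_le.2 hP)
      have : {θ : ℝ | (s:ℂ) * ep θ ∈ U \ ball 0 R} = ∅ := by
        ext θ
        simp only [mem_ofPred_eq, mem_empty_iff_false, iff_false]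
        rintro ⟨h2, -⟩
        have : (s:ℂ) * ep θ ∈ sphere (0:ℂ) s ∩ U := ⟨by rw [mem_sphere_zero_iff_norm, hns], h2⟩
        rw [hdis] at this; exact this
      rw [this]; simp
  calc _ ≤ ENNReal.ofReal (g R) * ∫⁻ s in Ioi (0:ℝ), (toMeasurable volume S).indicator (fun _ => ENNReal.ofReal Real.pi * P g U) s := by
        gcongr ENNReal.ofReal (g R) * ?_
        exact setLIntegral_mono' measurableSet_Ioi (fun s hs => hkey s hs)
    _ ≤ ENNReal.ofReal (g R) * ∫⁻ s, (toMeasurable volume S).indicator (fun _ => ENNReal.ofReal Real.pi * P g U) s := by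
        gcongr ENNReal.ofReal (g R) * ?_
        exact setLIntegral_le_lintegral _ _
    _ = ENNReal.ofReal (g R) * (ENNReal.ofReal Real.pi * P g U * volume S) := by
        rw [lintegral_indicator_const (measurableSet_toMeasurable _ _), measure_toMeasurable]
    _ = ENNReal.ofReal Real.pi * P g U * (ENNReal.ofReal (g R) * volume S) := by ring
    _ ≤ _ := by gcongr

end Isop
end

section
open Set MeasureTheory Filter Topology Metric
open scoped ENNReal NNReal MeasureTheory Pointwise
namespace Isop
variable {g : ℝ → ℝ}

noncomputable def I (g : ℝ → ℝ) (v : ℝ≥0∞) : ℝ≥0∞ :=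
  ⨅ (U : Set ℂ) (_ : IsOpen U) (_ : v ≤ nu g U) (_ : nu g U ≠ ∞), P g U

lemma I_le {U : Set ℂ} (hU : IsOpen U) {v : ℝ≥0∞} (hv : v ≤ nu g U) (hf : nu g U ≠ ∞) : I g v ≤ P g U :=
  iInf₂_le_of_le U hU (iInf₂_le_of_le hv hf le_rfl)

lemma I_mono {v w : ℝ≥0∞} (h : v ≤ w) : I g v ≤ I g w := by
  unfold I
  refine le_iInf fun U => le_iInf fun hU => le_iInf fun hv => le_iInf fun hf => ?_
  exact I_le hU (h.trans hv) hf

lemma I_exists (hg : Dens g) {v c : ℝ≥0∞} (h : I g v < c) : ∃ U, IsOpen U ∧ nu g U = v ∧ P g U < c := by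
  unfold I at h
  simp only [iInf_lt_iff] at h
  obtain ⟨U, hU, hv, hf, hc⟩ := h
  obtain ⟨U', -, h1, h2, h3⟩ := exists_trunc hg hU hf hv
  exact ⟨U', h1, h2, h3.trans_lt hc⟩

lemma P_ball_le (hg : Dens g) {r : ℝ} (hr : 0 < r) :
    P g (ball 0 r) ≤ ENNReal.ofReal (g r) * (ENNReal.ofReal r * c1) := by
  rw [P, frontier_ball _ hr.ne', ← H_sphere hr]
  exact pw_le hg isClosed_sphere.measurableSet (fun z hz => by simp at hz; exact hz.le)

lemma P_ball_fin (hg : Dens g) (r : ℝ) : P g (ball 0 r) ≠ ∞ := by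
  rcases le_or_gt r 0 with h | h
  · rw [ball_eq_empty.2 h, P_empty]; simp
  · refine ne_top_of_le_ne_top ?_ (P_ball_le hg h)
    exact ENNReal.mul_ne_top (by simp) (ENNReal.mul_ne_top (by simp) c1_fin)

lemma I_fin (hg : Dens g) {v : ℝ≥0∞} (hv : v ≠ ∞) : I g v ≠ ∞ := by
  obtain ⟨r, hr⟩ := exists_ball hg hv
  exact ne_top_of_le_ne_top (P_ball_fin hg r) (I_le isOpen_ball hr.ge (hr ▸ hv))

lemma angle_big (hg : Dens g) {U : Set ℂ} (hU : IsOpen U) (hf : nu g U ≠ ∞) {ρ : ℝ} (hρ : 0 < ρ) {q : ℝ≥0∞}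
    (hP : P g U ≤ ENNReal.ofReal (g ρ) * ENNReal.ofReal ρ * q) {x : ℂ} (hx : ρ ≤ ‖x‖) :
    c1 - q ≤ volume (Ioo (-Real.pi) Real.pi ∩ {θ | x * ep θ ∈ Uᶜ}) := by
  set m := volume (Ioo (-Real.pi) Real.pi ∩ {θ | x * ep θ ∈ Uᶜ}) with hm
  have hx0 : 0 < ‖x‖ := hρ.trans_le hx
  have h1 := H_sphere_sub x Uᶜ
  have h2 := slice_le hg hU hf hx0
  have h3 := H_sphere hx0
  have h4 : μH[1] (sphere (0:ℂ) ‖x‖) ≤ μH[1] (sphere (0:ℂ) ‖x‖ ∩ U) + μH[1] (sphere (0:ℂ) ‖x‖ ∩ Uᶜ) := by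
    rw [← inter_union_compl (sphere (0:ℂ) ‖x‖) U]
    refine (measure_union_le _ _).trans ?_
    rw [inter_union_compl]
  rw [tsub_le_iff_left]
  set K := ENNReal.ofReal (g ‖x‖) * ENNReal.ofReal ‖x‖ with hK
  have hK0 : K ≠ 0 := by
    have := hg.pos ‖x‖
    refine mul_ne_zero ?_ ?_ <;> simp [this]
    intro h; simp [h] at hx0
  have hKt : K ≠ ∞ := ENNReal.mul_ne_top (by simp) (by simp)
  rw [← ENNReal.mul_le_mul_iff_right hK0 hKt]
  calc K * c1 = ENNReal.ofReal (g ‖x‖) * μH[1] (sphere (0:ℂ) ‖x‖) := by rw [h3, hK]; ring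
    _ ≤ ENNReal.ofReal (g ‖x‖) * (μH[1] (sphere (0:ℂ) ‖x‖ ∩ U) + μH[1] (sphere (0:ℂ) ‖x‖ ∩ Uᶜ)) := by gcongr
    _ = ENNReal.ofReal (g ‖x‖) * μH[1] (sphere (0:ℂ) ‖x‖ ∩ U) + ENNReal.ofReal (g ‖x‖) * μH[1] (sphere (0:ℂ) ‖x‖ ∩ Uᶜ) := mul_add _ _ _
    _ ≤ ENNReal.ofReal (g ρ) * ENNReal.ofReal ρ * q + ENNReal.ofReal (g ‖x‖) * (ENNReal.ofReal ‖x‖ * m) := by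
        refine add_le_add (h2.trans hP) (mul_le_mul_right h1 _)
    _ ≤ K * q + K * m := by
        refine add_le_add ?_ (by rw [hK, mul_assoc])
        rw [hK]
        gcongr
        exact hg.mono _ _ hρ.le hx
    _ = _ := by ring

lemma rot_big (hg : Dens g) {U : Set ℂ} (hU : IsOpen U) (hf : nu g U ≠ ∞) {ρ : ℝ} (hρ : 0 < ρ) {q : ℝ≥0∞}
    (hP : P g U ≤ ENNReal.ofReal (g ρ) * ENNReal.ofReal ρ * q) :
    (c1 - q) * nu g (U \ ball 0 ρ) ≤ ∫⁻ α in Ioo (-Real.pi) Real.pi, nu g (U \ rot α U) := by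
  have : SFinite (nu g) := by unfold nu; infer_instance
  set S : Set (ℝ × ℂ) := {p | p.2 ∈ U ∧ ep p.1 * p.2 ∉ U} with hS
  have hSm : MeasurableSet S := by
    have h1 : Continuous (fun p : ℝ × ℂ => ep p.1 * p.2) := by
      have := ep_cont; fun_prop
    exact (continuous_snd.measurable hU.measurableSet).inter (h1.measurable hU.measurableSet).compl
  have e1 : ∫⁻ α in Ioo (-Real.pi) Real.pi, nu g (U \ rot α U) =
      ((volume.restrict (Ioo (-Real.pi) Real.pi)).prod (nu g)) S := by
    rw [Measure.prod_apply hSm]; rfl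
  rw [e1, Measure.prod_apply_symm hSm, ← setLIntegral_const]
  refine (setLIntegral_mono' (hU.measurableSet.diff measurableSet_ball) ?_).trans (setLIntegral_le_lintegral _ _)
  intro x hx
  have hx2 : ρ ≤ ‖x‖ := by simpa using hx.2
  refine (angle_big hg hU hf hρ hP hx2).trans ?_
  rw [Measure.restrict_apply (measurable_prodMk_right hSm)]
  refine measure_mono ?_
  rintro θ ⟨h1, h2⟩
  refine ⟨⟨hx.1, ?_⟩, h1⟩
  rw [mul_comm]; exact h2

lemma cont_rot (hg : Dens g) {U : Set ℂ} (hU : IsOpen U) (hf : nu g U ≠ ∞) (hP : P g U ≠ ∞) :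
    Continuous (fun α : ℝ => nu g (U ∩ rot α U)) := by
  rw [continuous_iff_continuousAt]
  intro a
  refine tendsto_measure_of_ae_tendsto_indicator (𝓝 a) (hU.inter (rot_open _ hU)).measurableSet
    (fun r => (hU.inter (rot_open _ hU)).measurableSet) (B := U) hU.measurableSet
    hf (Eventually.of_forall fun _ => inter_subset_left) ?_
  have h0 : nu g (rot a (frontier U)) = 0 := by
    rw [← frontier_rot]; exact nu_null' hg (by rw [P_rot hg]; exact hP)
  filter_upwards [measure_eq_zero_iff_ae_notMem.1 h0] with x hx
  have hc : Continuous (fun α : ℝ => ep α * x) := by have := ep_cont; fun_prop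
  by_cases h : ep a * x ∈ U
  · filter_upwards [hc.continuousAt.preimage_mem_nhds (hU.mem_nhds h)] with b hb
    have hb' : ep b * x ∈ U := hb
    simp [rot, h, hb']
  · have h' : ep a * x ∈ (closure U)ᶜ := by
      intro h2
      apply hx
      change ep a * x ∈ frontier U
      rw [hU.frontier_eq]
      exact ⟨h2, h⟩
    filter_upwards [hc.continuousAt.preimage_mem_nhds (isClosed_closure.isOpen_compl.mem_nhds h')] with b hb
    have hb' : ep b * x ∉ U := fun h => hb (subset_closure h)
    simp [rot, h, hb']

lemma concave_chain (J : ℝ → ℝ) (V ε w0 : ℝ) (hε : 0 < ε) (hw : 0 < w0) (hJ0 : ∀ v, 0 ≤ J v)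
    (h : ∀ V', V - ε ≤ V' → V' ≤ V → ∀ w, 0 ≤ w → w ≤ w0 → J (V' + w) + J (V' - w) ≤ 2 * J V') :
    ∀ v, 0 ≤ v → v ≤ min w0 (ε / 2) → J V ≤ J (V - v) + (2 * J V / ε) * v := by
  intro v hv0 hv
  rcases eq_or_lt_of_le hv0 with h0 | h0
  · subst h0; simp
  have hv1 : v ≤ w0 := hv.trans (min_le_left _ _)
  have hv2 : v ≤ ε / 2 := hv.trans (min_le_right _ _)
  set k := ⌊ε / v⌋₊ with hk
  have hk1 : (k:ℝ) * v ≤ ε := by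
    have := Nat.floor_le (show 0 ≤ ε / v by positivity)
    rwa [le_div_iff₀ h0] at this
  have hk2 : ε / v < k + 1 := Nat.lt_floor_add_one _
  rw [div_lt_iff₀ h0] at hk2
  set D : ℕ → ℝ := fun j => J (V - j * v) - J (V - (j + 1 : ℕ) * v) with hD
  have hmon : ∀ j : ℕ, j + 1 ≤ k → D 0 ≤ D j := by
    intro j
    induction j with
    | zero => intro _; exact le_rfl
    | succ j ih =>
      intro hj
      refine (ih (by omega)).trans ?_
      have hjk : ((j:ℝ) + 1) * v ≤ ε := by
        have : ((j + 1 : ℕ) : ℝ) ≤ k := by exact_mod_cast (by omega : j + 1 ≤ k)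
        push_cast at this
        nlinarith
      have := h (V - (j + 1) * v) (by linarith) (by
        have : 0 ≤ ((j:ℝ) + 1) * v := by positivity
        linarith) v hv0 hv1
      have e1 : V - ((j:ℝ) + 1) * v + v = V - j * v := by ring
      have e2 : V - ((j:ℝ) + 1) * v - v = V - (j + 1 + 1) * v := by ring
      rw [e1, e2] at this
      simp only [hD]; push_cast
      linarith
  have hsum : (k:ℝ) * D 0 ≤ J V := by
    have h1 : ∑ j ∈ Finset.range k, D j = J (V - (0:ℕ) * v) - J (V - k * v) :=
      Finset.sum_range_sub' (fun j : ℕ => J (V - j * v)) k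
    have h2 : ∑ j ∈ Finset.range k, D 0 ≤ ∑ j ∈ Finset.range k, D j :=
      Finset.sum_le_sum fun j hj => hmon j (by have := Finset.mem_range.1 hj; omega)
    rw [Finset.sum_const, Finset.card_range, nsmul_eq_mul] at h2
    have := hJ0 (V - k * v)
    simp at h1
    linarith
  have hD0 : D 0 = J V - J (V - v) := by simp [hD]
  rw [← sub_le_iff_le_add', ← hD0]
  have hkv : ε ≤ 2 * (k * v) := by nlinarith
  rw [div_mul_eq_mul_div, le_div_iff₀ hε]
  rcases le_or_gt (D 0) 0 with hneg | hpos
  · have : 0 ≤ 2 * J V * v := by have := hJ0 V; positivity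
    nlinarith
  · nlinarith [mul_le_mul_of_nonneg_right hsum hv0, mul_le_mul_of_nonneg_left hkv hpos.le]

end Isop
end

section
open Set MeasureTheory Filter Topology Metric
open scoped ENNReal NNReal MeasureTheory Pointwise
namespace Isop
variable {g : ℝ → ℝ}

lemma conc_step (hg : Dens g) {U : Set ℂ} (hU : IsOpen U) {V' w0 : ℝ} (hV' : nu g U = ENNReal.ofReal V')
    (hV0 : 0 ≤ V') (hP : P g U ≠ ∞) {α : ℝ} (hw0 : 0 < w0) (hα : ENNReal.ofReal w0 ≤ nu g (U \ rot α U))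
    {w : ℝ} (hw : 0 ≤ w) (hw' : w ≤ w0) :
    I g (ENNReal.ofReal (V' + w)) + I g (ENNReal.ofReal (V' - w)) ≤ 2 * P g U := by
  have hf : nu g U ≠ ∞ := by rw [hV']; simp
  have hwV : w0 ≤ V' := by
    have := hα.trans (measure_mono (sdiff_subset : U \ rot α U ⊆ U))
    rw [hV'] at this
    exact (ENNReal.ofReal_le_ofReal_iff hV0).1 this
  have h1 : nu g (U ∩ rot α U) ≤ ENNReal.ofReal (V' - w) := by
    have := measure_inter_add_sdiff (μ := nu g) U (rot_open α hU).measurableSet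
    rw [hV'] at this
    have h2 : nu g (U ∩ rot α U) + ENNReal.ofReal w0 ≤ ENNReal.ofReal (V' - w0) + ENNReal.ofReal w0 := by
      rw [← ENNReal.ofReal_add (by linarith) hw0.le, sub_add_cancel, ← this]
      gcongr
    have h3 := (ENNReal.add_le_add_iff_right (by simp)).1 h2
    exact h3.trans (ENNReal.ofReal_le_ofReal (by linarith))
  have h0 : ENNReal.ofReal (V' - w) ≤ nu g (U ∩ rot 0 U) := by
    have : rot 0 U = U := by simp [rot, ep]
    rw [this, inter_self, hV']
    exact ENNReal.ofReal_le_ofReal (by linarith)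
  obtain ⟨β, hβ⟩ := mem_range_of_exists_le_of_exists_ge (cont_rot hg hU hf hP) ⟨α, h1⟩ ⟨0, h0⟩
  dsimp only at hβ
  have hUn : nu g (U ∪ rot β U) = ENNReal.ofReal (V' + w) := by
    have := measure_union_add_inter (μ := nu g) U (rot_open β hU).measurableSet
    rw [hβ, nu_rot hg β hU.measurableSet, hV', ← ENNReal.ofReal_add hV0 hV0,
      show V' + V' = (V' + w) + (V' - w) by ring, ENNReal.ofReal_add (by linarith) (by linarith)] at this
    exact (ENNReal.add_left_inj (by simp)).1 this
  have h2 := submod g hU (rot_open β hU)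
  rw [P_rot hg, ← two_mul] at h2
  refine le_trans (add_le_add ?_ ?_) h2
  · exact I_le (hU.union (rot_open β hU)) hUn.ge (by rw [hUn]; simp)
  · exact I_le (hU.inter (rot_open β hU)) hβ.ge (by rw [hβ]; simp)

lemma lin_bound (hg : Dens g) {V : ℝ} (hV : 0 < V) {R : ℝ} (hR : nu g (ball 0 R) = ENNReal.ofReal V)
    (hI : I g (ENNReal.ofReal V) < P g (ball 0 R)) :
    ∃ l v1 : ℝ, 0 ≤ l ∧ 0 < v1 ∧ v1 ≤ V ∧ ∀ v, 0 ≤ v → v ≤ v1 →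
      I g (ENNReal.ofReal V) ≤ I g (ENNReal.ofReal (V - v)) + ENNReal.ofReal (l * v) := by
  have hR0 : 0 < R := by
    by_contra h
    rw [ball_eq_empty.2 (not_lt.1 h)] at hR
    simp at hR; linarith
  have hc1 := c1_fin
  have hlt : I g (ENNReal.ofReal V) < ENNReal.ofReal (g R) * ENNReal.ofReal R * c1 := by
    rw [mul_assoc]; exact hI.trans_le (P_ball_le hg hR0)
  have hcont : Continuous (fun r : ℝ => ENNReal.ofReal (g r) * ENNReal.ofReal r * c1) := by
    have h1 : Continuous (fun r : ℝ => ENNReal.ofReal (g r * |r|) * c1) := by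
      have := hg.cont
      exact (ENNReal.continuous_mul_const hc1).comp (ENNReal.continuous_ofReal.comp (by fun_prop))
    have h2 : Continuous (fun r : ℝ => ENNReal.ofReal (g r * max r 0) * c1) := by
      have := hg.cont
      exact (ENNReal.continuous_mul_const hc1).comp (ENNReal.continuous_ofReal.comp (by fun_prop))
    convert h2 using 2 with r
    rw [← ENNReal.ofReal_mul (hg.pos r).le]
    rcases le_total r 0 with h | h
    · rw [max_eq_right h, mul_zero, ENNReal.ofReal_zero, ENNReal.ofReal_of_nonpos]
      exact mul_nonpos_of_nonneg_of_nonpos (hg.pos r).le h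
    · rw [max_eq_left h]
  obtain ⟨ρ, hρlt, hρ0, hρR⟩ : ∃ ρ, I g (ENNReal.ofReal V) < ENNReal.ofReal (g ρ) * ENNReal.ofReal ρ * c1 ∧ 0 < ρ ∧ ρ < R := by
    have h1 : ∀ᶠ r in 𝓝[<] R, I g (ENNReal.ofReal V) < ENNReal.ofReal (g r) * ENNReal.ofReal r * c1 :=
      (hcont.continuousAt.eventually (lt_mem_nhds hlt)).filter_mono nhdsWithin_le_nhds
    have h2 : ∀ᶠ r in 𝓝[<] R, 0 < r := (Ioi_mem_nhds hR0 |> fun h => mem_nhdsWithin_of_mem_nhds h)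
    have h3 : ∀ᶠ r in 𝓝[<] R, r < R := self_mem_nhdsWithin
    obtain ⟨r, h⟩ := (h1.and (h2.and h3)).exists
    exact ⟨r, h.1, h.2.1, h.2.2⟩
  obtain ⟨P0, hP0, hP0'⟩ := exists_between hρlt
  set K := ENNReal.ofReal (g ρ) * ENNReal.ofReal ρ with hK
  have hK0 : K ≠ 0 := by
    have := hg.pos ρ
    refine mul_ne_zero ?_ ?_ <;> simp [this, hρ0]
  have hKt : K ≠ ∞ := ENNReal.mul_ne_top (by simp) (by simp)
  set q := P0 / K with hq
  have hqK : P0 = K * q := (ENNReal.mul_div_cancel hK0 hKt).symm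
  have hqc : q < c1 := by
    rw [hq]; exact ENNReal.div_lt_of_lt_mul' hP0'
  set e := (c1 - q).toReal with he
  have hef : c1 - q ≠ ∞ := ne_top_of_le_ne_top c1_fin tsub_le_self
  have he0 : 0 < e := ENNReal.toReal_pos (tsub_pos_of_lt hqc).ne' hef
  -- the volume gap
  have hgap : nu g (ball 0 ρ) < ENNReal.ofReal V := by
    rw [← hR]
    have hopen : IsOpen (ball (0:ℂ) R \ closedBall 0 ρ) := isOpen_ball.sdiff isClosed_closedBall
    have hpos : 0 < nu g (ball (0:ℂ) R \ closedBall 0 ρ) := by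
      refine lt_of_lt_of_le ?_ (nu_ge hg le_rfl hopen.measurableSet (fun z _ => norm_nonneg z))
      refine ENNReal.mul_pos (by simpa using g0_pos hg) (hopen.measure_pos _ ?_).ne'
      refine ⟨(((ρ + R) / 2 : ℝ) : ℂ), ?_⟩
      simp only [mem_diff, mem_ball_zero_iff, mem_closedBall_zero_iff, Complex.norm_real,
        Real.norm_of_nonneg (show 0 ≤ (ρ + R) / 2 by linarith)]
      constructor <;> linarith
    have hle : nu g (ball 0 ρ) + nu g (ball (0:ℂ) R \ closedBall 0 ρ) ≤ nu g (ball 0 R) := by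
      rw [← measure_union _ hopen.measurableSet]
      · exact measure_mono (union_subset (ball_subset_ball hρR.le) sdiff_subset)
      · rw [Set.disjoint_left]
        intro x hx hx'
        exact hx'.2 (ball_subset_closedBall hx)
    exact (ENNReal.lt_add_right (nu_ball_lt hg _).ne hpos.ne').trans_le hle
  set b := (nu g (ball 0 ρ)).toReal with hb
  have hb' : nu g (ball 0 ρ) = ENNReal.ofReal b := (ENNReal.ofReal_toReal (nu_ball_lt hg _).ne).symm
  have hbV : b < V := by rw [hb', ENNReal.ofReal_lt_ofReal_iff hV] at hgap; exact hgap
  have hb0 : 0 ≤ b := ENNReal.toReal_nonneg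
  set δ := V - b with hδ
  have hδ0 : 0 < δ := by linarith
  have hpi := Real.pi_pos
  set w0 := e * δ / (8 * Real.pi) with hw0
  have hw00 : 0 < w0 := by positivity
  -- concavity
  set J : ℝ → ℝ := fun v => (I g (ENNReal.ofReal v)).toReal with hJ
  have hJe : ∀ v, I g (ENNReal.ofReal v) = ENNReal.ofReal (J v) := fun v =>
    (ENNReal.ofReal_toReal (I_fin hg (by simp))).symm
  have hJ0 : ∀ v, 0 ≤ J v := fun v => ENNReal.toReal_nonneg
  have hconc : ∀ V', V - δ / 2 ≤ V' → V' ≤ V → ∀ w, 0 ≤ w → w ≤ w0 → J (V' + w) + J (V' - w) ≤ 2 * J V' := by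
    intro V' h1 h2 w hw hw'
    have hV'0 : 0 ≤ V' := by linarith
    have hIV' : I g (ENNReal.ofReal V') < P0 := (I_mono (ENNReal.ofReal_le_ofReal h2)).trans_lt hP0
    have hstep : ∀ c, I g (ENNReal.ofReal V') < c → I g (ENNReal.ofReal (V' + w)) + I g (ENNReal.ofReal (V' - w)) ≤ 2 * c := by
      intro c hc
      obtain ⟨U, hU, hUv, hUP⟩ := I_exists hg (lt_min hIV' hc)
      have hUP0 : P g U < P0 := hUP.trans_le (min_le_left _ _)
      have hf : nu g U ≠ ∞ := by rw [hUv]; simp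
      have hrb := rot_big hg hU hf hρ0 (q := q) (by rw [← hK, ← hqK]; exact hUP0.le)
      have hUb : ENNReal.ofReal (δ / 2) ≤ nu g (U \ ball 0 ρ) := by
        have h3 : nu g U ≤ nu g (ball 0 ρ) + nu g (U \ ball 0 ρ) := by
          refine le_trans (measure_mono ?_) (measure_union_le _ _)
          intro x hx
          by_cases h : x ∈ ball 0 ρ
          · exact Or.inl h
          · exact Or.inr ⟨hx, h⟩
        rw [hUv, hb', ← tsub_le_iff_left, ← ENNReal.ofReal_sub _ hb0] at h3
        exact (ENNReal.ofReal_le_ofReal (by linarith)).trans h3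
      obtain ⟨α, hα⟩ : ∃ α, ENNReal.ofReal w0 ≤ nu g (U \ rot α U) := by
        by_contra hcon
        push Not at hcon
        have h4 : ∫⁻ α in Ioo (-Real.pi) Real.pi, nu g (U \ rot α U) ≤ ENNReal.ofReal w0 * ENNReal.ofReal (2 * Real.pi) := by
          calc _ ≤ ∫⁻ α in Ioo (-Real.pi) Real.pi, ENNReal.ofReal w0 := lintegral_mono fun α => (hcon α).le
            _ = _ := by rw [setLIntegral_const, Real.volume_Ioo]; ring_nf
        have h5 : ENNReal.ofReal e * ENNReal.ofReal (δ / 2) ≤ ENNReal.ofReal w0 * ENNReal.ofReal (2 * Real.pi) := by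
          refine le_trans ?_ (hrb.trans h4)
          rw [he, ENNReal.ofReal_toReal hef]
          gcongr
        rw [← ENNReal.ofReal_mul he0.le, ← ENNReal.ofReal_mul hw00.le, ENNReal.ofReal_le_ofReal_iff (by positivity)] at h5
        have h6 : w0 * (2 * Real.pi) = e * δ / 4 := by rw [hw0]; field_simp; norm_num
        have : 0 < e * δ := by positivity
        nlinarith
      have := conc_step hg hU hUv hV'0 hUP0.ne_top hw00 hα hw hw'
      refine this.trans ?_
      gcongr
      exact (hUP.le).trans (min_le_right _ _)
    have hfin : I g (ENNReal.ofReal (V' + w)) + I g (ENNReal.ofReal (V' - w)) ≤ 2 * I g (ENNReal.ofReal V') := by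
      have h7 : (I g (ENNReal.ofReal (V' + w)) + I g (ENNReal.ofReal (V' - w))) / 2 ≤ I g (ENNReal.ofReal V') := by
        refine le_of_forall_gt fun c hc => ?_
        obtain ⟨d, hd1, hd2⟩ := exists_between hc
        refine lt_of_le_of_lt ?_ hd2
        exact ENNReal.div_le_of_le_mul' (hstep d hd1)
      rw [ENNReal.div_le_iff_le_mul (by simp) (by simp)] at h7
      rw [mul_comm]; exact h7
    rw [hJe, hJe, hJe, ← ENNReal.ofReal_add (hJ0 _) (hJ0 _), show (2:ℝ≥0∞) = ENNReal.ofReal 2 by simp,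
      ← ENNReal.ofReal_mul (by norm_num), ENNReal.ofReal_le_ofReal_iff (by have := hJ0 V'; positivity)] at hfin
    exact hfin
  refine ⟨2 * J V / (δ / 2), min w0 (δ / 2 / 2), ?_, ?_, ?_, ?_⟩
  · have := hJ0 V; positivity
  · exact lt_min hw00 (by positivity)
  · refine (min_le_right _ _).trans ?_; linarith
  · intro v hv hv'
    have := concave_chain J V (δ / 2) w0 (by positivity) hw00 hJ0 hconc v hv hv'
    rw [hJe, hJe, ← ENNReal.ofReal_add (hJ0 _)]
    · exact ENNReal.ofReal_le_ofReal this
    · have := hJ0 V; positivity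

end Isop
end

section
open Set MeasureTheory Filter Topology Metric
open scoped ENNReal NNReal MeasureTheory Pointwise
namespace Isop
variable {g : ℝ → ℝ}

lemma im_lip : LipschitzWith 1 Complex.im := LipschitzWith.of_dist_le_mul fun x y => by
    rw [Real.dist_eq, dist_eq_norm, ← Complex.sub_im]; simpa using Complex.abs_im_le_norm (x - y)

lemma vol_strip (a b : ℝ) (T : Set ℝ) :
    volume {z : ℂ | z.re ∈ Icc a b ∧ z.im ∈ T} ≤ ENNReal.ofReal (b - a) * volume T := by
  have h := Complex.volume_preserving_equiv_real_prod
  have hm : MeasurableSet (Icc a b ×ˢ toMeasurable volume T) :=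
    measurableSet_Icc.prod (measurableSet_toMeasurable _ _)
  calc _ ≤ volume (Complex.measurableEquivRealProd ⁻¹' (Icc a b ×ˢ toMeasurable volume T)) := by
        refine measure_mono ?_
        rintro z ⟨h1, h2⟩
        exact ⟨h1, subset_toMeasurable _ _ h2⟩
    _ = volume (Icc a b ×ˢ toMeasurable volume T) := h.measure_preimage hm.nullMeasurableSet
    _ = _ := by rw [Measure.volume_eq_prod, Measure.prod_prod, Real.volume_Icc, measure_toMeasurable]

lemma iso {W : Set ℂ} {x p : ℂ} {ρ : ℝ} (hρ : 0 < ρ) (hS : sphere x ρ ∩ W = ∅)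
    (hp : sphere x ρ ∩ frontier W ⊆ {p}) :
    volume (W ∩ ball x ρ) ≤ ENNReal.ofReal (2 * ρ) * μH[1] (frontier W ∩ ball x ρ) := by
  set T := Complex.im '' (frontier W ∩ ball x ρ) with hT
  have h1 : volume T ≤ μH[1] (frontier W ∩ ball x ρ) := mult1 im_lip Subset.rfl
  have hsub : W ∩ ball x ρ ⊆ {z : ℂ | z.re ∈ Icc (x.re - ρ) (x.re + ρ) ∧ z.im ∈ T ∪ {p.im}} := by
    rintro z ⟨hzW, hz⟩
    have hz' : ‖z - x‖ < ρ := by rwa [mem_ball, dist_eq_norm] at hz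
    refine ⟨?_, ?_⟩
    · have := (Complex.abs_re_le_norm (z - x)).trans hz'.le
      rw [Complex.sub_re, abs_le] at this
      constructor <;> linarith
    -- move right
    have hpc : IsPreconnected ((fun t : ℝ => z + (t:ℂ)) '' Ici 0) :=
      isPreconnected_Ici.image _ (by fun_prop)
    have hcontn : ContinuousOn (fun t : ℝ => ‖z + (t:ℂ) - x‖) (Icc 0 (2 * ρ)) := by fun_prop
    have hlast : ρ ≤ ‖z + ((2 * ρ : ℝ) : ℂ) - x‖ := by
      have e : z + ((2 * ρ : ℝ) : ℂ) - x = ((2 * ρ : ℝ) : ℂ) - (x - z) := by ring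
      rw [e]
      have := norm_sub_norm_le ((2 * ρ : ℝ) : ℂ) (x - z)
      rw [Complex.norm_real, Real.norm_of_nonneg (by positivity), norm_sub_rev x z] at this
      linarith
    obtain ⟨t, ht, hte⟩ := intermediate_value_Icc (by positivity) hcontn
      (show ρ ∈ Icc _ _ from ⟨by simpa using hz'.le, hlast⟩)
    have htS : z + (t:ℂ) ∈ sphere x ρ := by rw [mem_sphere, dist_eq_norm]; exact hte
    have hpc : IsPreconnected (segment ℝ z (z + (t:ℂ))) := (convex_segment _ _).isPreconnected
    obtain ⟨y, hy1, hy2⟩ := preconn_frontier hpc (s := W) ⟨z, left_mem_segment _ _ _, hzW⟩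
      ⟨_, right_mem_segment _ _ _, fun h => by
        have : z + (t:ℂ) ∈ sphere x ρ ∩ W := ⟨htS, h⟩
        rw [hS] at this; exact this⟩
    have hyim : y.im = z.im := by
      obtain ⟨a, b, -, -, hab, rfl⟩ := hy1
      simp [Complex.add_im]
      rw [← add_mul, hab, one_mul]
    have hycl : y ∈ closedBall x ρ :=
      (convex_closedBall x ρ).segment_subset (ball_subset_closedBall hz) (sphere_subset_closedBall htS) hy1
    rcases eq_or_lt_of_le (mem_closedBall.1 hycl) with h | h
    · right
      have := hp ⟨h, hy2⟩
      rw [← hyim, mem_singleton_iff.1 this]; rfl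
    · left
      exact ⟨y, ⟨hy2, h⟩, hyim⟩
  calc _ ≤ _ := measure_mono hsub
    _ ≤ ENNReal.ofReal ((x.re + ρ) - (x.re - ρ)) * volume (T ∪ {p.im}) := vol_strip _ _ _
    _ ≤ _ := by
      have : volume (T ∪ {p.im}) ≤ volume T := by
        refine (measure_union_le _ _).trans ?_
        simp
      rw [show (x.re + ρ) - (x.re - ρ) = 2 * ρ by ring]
      gcongr
      exact this.trans h1

lemma circ_preconn (x p : ℂ) {ρ : ℝ} (hp : p ∈ sphere x ρ) : IsPreconnected (sphere x ρ \ {p}) := by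
  have hn : ‖x - p‖ = ρ := by rw [mem_sphere, dist_eq_norm, norm_sub_rev] at hp; exact hp
  by_cases h0 : x - p = 0
  · have : sphere x ρ \ {p} = ∅ := by
      rw [h0, norm_zero] at hn
      subst hn
      have := sub_eq_zero.1 h0
      subst this
      simp
    rw [this]; exact isPreconnected_empty
  have : sphere x ρ \ {p} = (fun θ : ℝ => x + (x - p) * ep θ) '' Ioo (-Real.pi) Real.pi := by
    ext y
    constructor
    · rintro ⟨hy, hyp⟩
      obtain ⟨θ, hθ, h⟩ := sphere_cover (x - p) (a := y - x) ⟨by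
        rw [hn, mem_sphere_zero_iff_norm, ← dist_eq_norm]; exact hy, fun h => hyp (by
          have : y - x = -(x - p) := h
          have : y = p := by linear_combination this
          exact this)⟩
      exact ⟨θ, hθ, by dsimp only at h ⊢; rw [h]; ring⟩
    · rintro ⟨θ, hθ, rfl⟩
      refine ⟨by rw [mem_sphere, dist_eq_norm]; simp [norm_ep, hn], ?_⟩
      intro h
      have h' : x + (x - p) * ep θ = p := h
      have h2 : (x - p) * (ep θ + 1) = 0 := by linear_combination h'
      have h3 : ep θ = -1 := by
        have := (mul_eq_zero.1 h2).resolve_left h0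
        linear_combination this
      have h4 := arg_ep (θ := θ) ⟨hθ.1, hθ.2.le⟩
      rw [h3, Complex.arg_neg_one] at h4
      exact absurd h4 hθ.2.ne'
  rw [this]
  exact isPreconnected_Ioo.image _ (by have := ep_cont; fun_prop)

/-- alternative on circles which meet the frontier at most once -/
lemma circ_alt {U : Set ℂ} (hU : IsOpen U) {x p : ℂ} {ρ : ℝ} (hp : sphere x ρ ∩ frontier U ⊆ {p}) :
    sphere x ρ ∩ U = ∅ ∨ sphere x ρ \ frontier U ⊆ U := by
  have key : IsPreconnected (sphere x ρ \ frontier U) := by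
    by_cases h : p ∈ sphere x ρ ∩ frontier U
    · have : sphere x ρ \ frontier U = sphere x ρ \ {p} := by
        ext y
        constructor
        · rintro ⟨h1, h2⟩
          exact ⟨h1, fun h3 => h2 (by rw [mem_singleton_iff.1 h3]; exact h.2)⟩
        · rintro ⟨h1, h2⟩
          exact ⟨h1, fun h3 => h2 (hp ⟨h1, h3⟩)⟩
      rw [this]; exact circ_preconn x p h.1
    · have : sphere x ρ \ frontier U = sphere x ρ := by
        ext y
        constructor
        · exact fun h => h.1
        · refine fun h1 => ⟨h1, fun h3 => h ?_⟩
          have := hp ⟨h1, h3⟩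
          rw [← mem_singleton_iff.1 this]; exact ⟨h1, h3⟩
      rw [this]; exact sphere_preconn x ρ
  by_contra hcon
  push Not at hcon
  obtain ⟨h1, h2⟩ := hcon
  obtain ⟨a, ha1, ha2⟩ := h1
  rw [not_subset] at h2
  obtain ⟨b, hb1, hb2⟩ := h2
  have haf : a ∉ frontier U := by rw [hU.frontier_eq]; exact fun h => h.2 ha2
  obtain ⟨y, hy1, hy2⟩ := preconn_frontier key ⟨a, ⟨ha1, haf⟩, ha2⟩ ⟨b, hb1, hb2⟩
  exact hy1.2 hy2

lemma frontier_cup {U : Set ℂ} (hU : IsOpen U) {x : ℂ} {ρ : ℝ} (hρ : ρ ≠ 0)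
    (h : sphere x ρ \ frontier U ⊆ U) : frontier (U ∪ ball x ρ) ⊆ frontier U \ ball x ρ := by
  rw [(hU.union isOpen_ball).frontier_eq, closure_union, closure_ball _ hρ]
  rintro y ⟨hy1, hy2⟩
  have hyU : y ∉ U := fun h => hy2 (Or.inl h)
  have hyB : y ∉ ball x ρ := fun h => hy2 (Or.inr h)
  refine ⟨?_, hyB⟩
  rcases hy1 with h1 | h1
  · rw [hU.frontier_eq]; exact ⟨h1, hyU⟩
  · by_contra hf
    refine hyU (h ⟨?_, hf⟩)
    exact le_antisymm (mem_closedBall.1 h1) (not_lt.1 hyB)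

lemma frontier_minus {U : Set ℂ} (hU : IsOpen U) {x : ℂ} {ρ : ℝ} (h : sphere x ρ ∩ U = ∅) :
    frontier (U \ closedBall x ρ) ⊆ frontier U \ ball x ρ := by
  have ho : IsOpen (U \ closedBall x ρ) := hU.sdiff isClosed_closedBall
  rw [ho.frontier_eq]
  rintro y ⟨hy1, hy2⟩
  have hyB : y ∉ ball x ρ := by
    intro hb
    obtain ⟨z, hz1, hz2⟩ := mem_closure_iff.1 hy1 _ isOpen_ball hb
    exact hz2.2 (ball_subset_closedBall hz1)
  refine ⟨?_, hyB⟩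
  rw [hU.frontier_eq]
  refine ⟨closure_mono sdiff_subset hy1, fun hyU => hy2 ⟨hyU, fun hc => ?_⟩⟩
  have : y ∈ sphere x ρ ∩ U := ⟨le_antisymm (mem_closedBall.1 hc) (not_lt.1 hyB), hyU⟩
  rw [h] at this; exact this

def Lin (g : ℝ → ℝ) (V l v1 : ℝ) : Prop := 0 ≤ l ∧ 0 < v1 ∧ v1 ≤ V ∧ ∀ v, 0 ≤ v → v ≤ v1 →
      I g (ENNReal.ofReal V) ≤ I g (ENNReal.ofReal (V - v)) + ENNReal.ofReal (l * v)

lemma cut (hg : Dens g) {V l v1 : ℝ} (hL : Lin g V l v1) (x : ℂ) :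
    ∃ η > 0, ∀ U, IsOpen U → nu g U = ENNReal.ofReal V → ∀ ε : ℝ≥0∞, ε ≠ ∞ → P g U ≤ I g (ENNReal.ofReal V) + ε →
      ∀ ρ, 0 < ρ → ρ < η → ∀ p, sphere x ρ ∩ frontier U ⊆ {p} →
      ENNReal.ofReal (g 0 / 2) * μH[1] (frontier U ∩ ball x ρ) ≤ ε := by
  obtain ⟨hl, hv1, hvV, hlin⟩ := hL
  set G := g (‖x‖ + 1) with hG
  have hG0 : 0 < G := hg.pos _
  have hg0 := g0_pos hg
  have hpi := Real.pi_pos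
  refine ⟨min 1 (min (g 0 / (4 * G * (l + 1))) (v1 / (G * Real.pi))), by positivity, ?_⟩
  intro U hU hUv ε hε hUP ρ hρ hρη p hp
  have hρ1 : ρ < 1 := hρη.trans_le (min_le_left _ _)
  have hρ2 : ρ < g 0 / (4 * G * (l + 1)) := hρη.trans_le ((min_le_right _ _).trans (min_le_left _ _))
  have hρ3 : ρ < v1 / (G * Real.pi) := hρη.trans_le ((min_le_right _ _).trans (min_le_right _ _))
  have hIf : I g (ENNReal.ofReal V) ≠ ∞ := I_fin hg (by simp)
  have hPf : P g U ≠ ∞ := ne_top_of_le_ne_top (by simp [hIf, hε]) hUP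
  have hKm : MeasurableSet (frontier U) := isClosed_frontier.measurableSet
  set h := μH[1] (frontier U ∩ ball x ρ) with hh
  have hhf : h ≠ ∞ := ne_top_of_le_ne_top (H_fin hg hKm hPf) (measure_mono inter_subset_left)
  have hpwK : ENNReal.ofReal (g 0) * h ≤ pw g (frontier U ∩ ball x ρ) := H_le_pw hg (hKm.inter measurableSet_ball)
  have hsplit : pw g (frontier U ∩ ball x ρ) + pw g (frontier U \ ball x ρ) = P g U :=
    measure_inter_add_sdiff _ measurableSet_ball
  have hhalf : ENNReal.ofReal (g 0) * h = ENNReal.ofReal (g 0 / 2) * h + ENNReal.ofReal (g 0 / 2) * h := by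
    rw [← add_mul, ← ENNReal.ofReal_add (by positivity) (by positivity), add_halves]
  have hUf : nu g U ≠ ∞ := by rw [hUv]; simp
  have hballn : ∀ z ∈ ball x ρ, ‖z‖ ≤ ‖x‖ + 1 := by
    intro z hz
    have : ‖z - x‖ < ρ := by rwa [mem_ball, dist_eq_norm] at hz
    have := norm_le_norm_add_norm_sub' z x
    linarith
  have hballf : nu g (ball x ρ) ≤ ENNReal.ofReal v1 := by
    refine (nu_le hg measurableSet_ball hballn).trans ?_
    rw [Complex.volume_ball, ← hG]
    have e : ((NNReal.pi : ℝ≥0) : ℝ≥0∞) = ENNReal.ofReal Real.pi := by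
      rw [← NNReal.coe_real_pi, ENNReal.ofReal_coe_nnreal]
    rw [e, ← ENNReal.ofReal_pow hρ.le, ← ENNReal.ofReal_mul (by positivity), ← ENNReal.ofReal_mul hG0.le]
    apply ENNReal.ofReal_le_ofReal
    rw [lt_div_iff₀ (by positivity)] at hρ3
    have h1 : ρ ^ 2 ≤ ρ := by nlinarith
    have h2 : 0 < G * Real.pi := by positivity
    nlinarith
  rcases circ_alt hU hp with hA | hB
  · -- remove the ball
    have ho : IsOpen (U \ closedBall x ρ) := hU.sdiff isClosed_closedBall
    have hPU' : P g (U \ closedBall x ρ) ≤ pw g (frontier U \ ball x ρ) := measure_mono (frontier_minus hU hA)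
    have heq : U ∩ closedBall x ρ = U ∩ ball x ρ := by
      ext y
      constructor
      · rintro ⟨h1, h2⟩
        refine ⟨h1, ?_⟩
        rcases eq_or_lt_of_le (mem_closedBall.1 h2) with h3 | h3
        · have : y ∈ sphere x ρ ∩ U := ⟨h3, h1⟩
          rw [hA] at this; exact this.elim
        · exact h3
      · rintro ⟨h1, h2⟩
        exact ⟨h1, ball_subset_closedBall h2⟩
    have hvs : nu g (U ∩ ball x ρ) + nu g (U \ closedBall x ρ) = nu g U := by
      rw [← heq]; exact measure_inter_add_sdiff _ isClosed_closedBall.measurableSet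
    have hvle : nu g (U ∩ ball x ρ) ≤ ENNReal.ofReal v1 := (measure_mono inter_subset_right).trans hballf
    set v := (nu g (U ∩ ball x ρ)).toReal with hv
    have hve : nu g (U ∩ ball x ρ) = ENNReal.ofReal v :=
      (ENNReal.ofReal_toReal (ne_top_of_le_ne_top (by simp) hvle)).symm
    have hv0 : 0 ≤ v := ENNReal.toReal_nonneg
    have hvv1 : v ≤ v1 := by rw [hve] at hvle; exact (ENNReal.ofReal_le_ofReal_iff hv1.le).1 hvle
    have hnuU' : nu g (U \ closedBall x ρ) = ENNReal.ofReal (V - v) := by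
      rw [hve, hUv, show V = v + (V - v) by ring, ENNReal.ofReal_add hv0 (by linarith)] at hvs
      have := (ENNReal.add_right_inj (by simp)).1 hvs
      rw [this]
    have hI1 : I g (ENNReal.ofReal (V - v)) ≤ P g (U \ closedBall x ρ) :=
      I_le ho hnuU'.ge (by rw [hnuU']; simp)
    have hI2 := hlin v hv0 hvv1
    have hvh : ENNReal.ofReal (l * v) ≤ ENNReal.ofReal (g 0 / 2) * h := by
      rw [ENNReal.ofReal_mul hl, ← hve]
      have h1 : nu g (U ∩ ball x ρ) ≤ ENNReal.ofReal G * (ENNReal.ofReal (2 * ρ) * h) := by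
        refine (nu_le hg (hU.measurableSet.inter measurableSet_ball) (fun z hz => hballn z hz.2)).trans ?_
        rw [← hG]
        gcongr
        exact iso hρ hA hp
      calc _ ≤ ENNReal.ofReal l * (ENNReal.ofReal G * (ENNReal.ofReal (2 * ρ) * h)) := by gcongr
        _ = ENNReal.ofReal (l * (G * (2 * ρ))) * h := by
          rw [ENNReal.ofReal_mul hl, ENNReal.ofReal_mul hG0.le]; ring
        _ ≤ _ := by
          gcongr
          rw [lt_div_iff₀ (by positivity)] at hρ2
          have : 0 < G * ρ := by positivity
          nlinarith
    -- combine
    have hfin : (I g (ENNReal.ofReal V) + ENNReal.ofReal (g 0 / 2) * h) + ENNReal.ofReal (g 0 / 2) * h ≤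
        (I g (ENNReal.ofReal V) + ENNReal.ofReal (g 0 / 2) * h) + ε := by
      calc _ = I g (ENNReal.ofReal V) + ENNReal.ofReal (g 0) * h := by rw [hhalf]; ring
        _ ≤ (P g (U \ closedBall x ρ) + ENNReal.ofReal (g 0 / 2) * h) + pw g (frontier U ∩ ball x ρ) :=
          add_le_add (hI2.trans (add_le_add hI1 hvh)) hpwK
        _ ≤ (pw g (frontier U \ ball x ρ) + ENNReal.ofReal (g 0 / 2) * h) + pw g (frontier U ∩ ball x ρ) := by gcongr
        _ = P g U + ENNReal.ofReal (g 0 / 2) * h := by rw [← hsplit]; ring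
        _ ≤ (I g (ENNReal.ofReal V) + ε) + ENNReal.ofReal (g 0 / 2) * h := by gcongr
        _ = _ := by ring
    refine (ENNReal.add_le_add_iff_left ?_).1 hfin
    exact ENNReal.add_ne_top.2 ⟨hIf, ENNReal.mul_ne_top (by simp) hhf⟩
  · -- add the ball
    have ho : IsOpen (U ∪ ball x ρ) := hU.union isOpen_ball
    have hPU' : P g (U ∪ ball x ρ) ≤ pw g (frontier U \ ball x ρ) := measure_mono (frontier_cup hU hρ.ne' hB)
    have hI1 : I g (ENNReal.ofReal V) ≤ P g (U ∪ ball x ρ) := by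
      refine I_le ho (by rw [← hUv]; exact measure_mono subset_union_left) ?_
      refine ne_top_of_le_ne_top ?_ (measure_union_le _ _)
      exact ENNReal.add_ne_top.2 ⟨hUf, ne_top_of_le_ne_top (by simp) hballf⟩
    have hfin : I g (ENNReal.ofReal V) + ENNReal.ofReal (g 0) * h ≤ I g (ENNReal.ofReal V) + ε := by
      refine le_trans ?_ hUP
      rw [← hsplit, add_comm]
      exact add_le_add hpwK (hI1.trans hPU')
    have := (ENNReal.add_le_add_iff_left hIf).1 hfin
    refine le_trans ?_ this
    gcongr
    linarith

end Isop
end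

section
open Set MeasureTheory Filter Topology Metric
open scoped ENNReal NNReal MeasureTheory Pointwise
namespace Isop
variable {g : ℝ → ℝ}

lemma ultra_lim (l : Ultrafilter ℕ) (b : ℕ → ℝ≥0∞) : ∃ β, Tendsto b l (𝓝 β) := by
  obtain ⟨β, -, h⟩ := isCompact_univ.ultrafilter_le_nhds (l.map b) (by simp)
  exact ⟨β, h⟩

lemma layer_ge {f h : ℝ} (hh : 0 < h) :
    ENNReal.ofReal f ≤ ∑' k : ℕ, ENNReal.ofReal h * (if (k:ℝ) * h < f then 1 else 0) := by
  refine le_trans ?_ (ENNReal.sum_le_tsum (Finset.range ⌈f / h⌉₊))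
  rw [Finset.sum_congr rfl (g := fun _ => ENNReal.ofReal h)]
  · rw [Finset.sum_const, Finset.card_range, nsmul_eq_mul, ← ENNReal.ofReal_natCast,
      ← ENNReal.ofReal_mul (by positivity)]
    apply ENNReal.ofReal_le_ofReal
    have := Nat.le_ceil (f / h)
    rwa [div_le_iff₀ hh] at this
  · intro k hk
    have := Nat.lt_ceil.1 (Finset.mem_range.1 hk)
    rw [lt_div_iff₀ hh] at this
    simp [this]

lemma layer_le {f h : ℝ} (hf : 0 ≤ f) (hh : 0 < h) (N : ℕ) :
    ∑ k ∈ Finset.range N, ENNReal.ofReal h * (if (k:ℝ) * h < f then 1 else 0)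
      ≤ ENNReal.ofReal f + ENNReal.ofReal h := by
  rw [← Finset.mul_sum, Finset.sum_boole, ← ENNReal.ofReal_add hf hh.le, ← ENNReal.ofReal_natCast,
    ← ENNReal.ofReal_mul hh.le]
  apply ENNReal.ofReal_le_ofReal
  have h1 : ((Finset.range N).filter fun k : ℕ => (k:ℝ) * h < f) ⊆ Finset.range ⌈f / h⌉₊ := by
    intro k hk
    rw [Finset.mem_filter] at hk
    rw [Finset.mem_range, Nat.lt_ceil, lt_div_iff₀ hh]
    exact hk.2
  have h2 := Finset.card_le_card h1
  rw [Finset.card_range] at h2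
  have h3 : ((((Finset.range N).filter fun k : ℕ => (k:ℝ) * h < f).card : ℕ) : ℝ) ≤ f / h + 1 :=
    le_trans (by exact_mod_cast h2) (Nat.ceil_lt_add_one (by positivity)).le
  calc _ ≤ h * (f / h + 1) := by gcongr
    _ = _ := by field_simp

lemma pw_lsc (hg : Dens g) (l : Ultrafilter ℕ) (Kn : ℕ → Set ℂ) (hKn : ∀ n, MeasurableSet (Kn n))
    (K : Set ℂ) (hK : MeasurableSet K) (J C : ℝ≥0∞) (hC : C ≠ ∞) (ε : ℕ → ℝ≥0∞)
    (hε : Tendsto ε l (𝓝 0)) (hP : ∀ n, pw g (Kn n) ≤ J + ε n) (hH : ∀ n, μH[1] (Kn n) ≤ C)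
    (hlsc : ∀ A, IsOpen A → ∀ c, (∃ᶠ n in l, μH[1] (Kn n ∩ A) ≤ c) → μH[1] (K ∩ A) ≤ c) :
    pw g K ≤ J := by
  have key : ∀ h : ℝ, 0 < h → pw g K ≤ J + ENNReal.ofReal h * C := by
    intro h hh
    set A : ℕ → Set ℂ := fun k => {z | (k:ℝ) * h < g ‖z‖} with hA
    have hAo : ∀ k, IsOpen (A k) := fun k =>
      isOpen_lt continuous_const (hg.cont.comp continuous_norm)
    have hAm := fun k => (hAo k).measurableSet
    have hind : ∀ (k : ℕ) (z : ℂ), (if (k:ℝ) * h < g ‖z‖ then (1:ℝ≥0∞) else 0) = (A k).indicator 1 z := by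
      intro k z; simp [Set.indicator, hA]
    have hI : ∀ (E : Set ℂ) k, ∫⁻ z in E, ENNReal.ofReal h * (A k).indicator 1 z ∂(μH[1])
        = ENNReal.ofReal h * μH[1] (E ∩ A k) := by
      intro E k
      rw [lintegral_const_mul _ (measurable_one.indicator (hAm k)), lintegral_indicator_one (hAm k),
        Measure.restrict_apply (hAm k), inter_comm]
    have hmeas : ∀ k, Measurable (fun z => ENNReal.ofReal h * (A k).indicator (1 : ℂ → ℝ≥0∞) z) :=
      fun k => (measurable_one.indicator (hAm k)).const_mul _
    have h1 : pw g K ≤ ∑' k, ENNReal.ofReal h * μH[1] (K ∩ A k) := by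
      rw [pw_apply hK]
      calc _ ≤ ∫⁻ z in K, ∑' k, ENNReal.ofReal h * (A k).indicator 1 z ∂(μH[1]) := by
            apply lintegral_mono
            intro z
            have := layer_ge (f := g ‖z‖) hh
            simp only [hind] at this
            exact this
        _ = _ := by
            rw [lintegral_tsum fun k => (hmeas k).aemeasurable]
            simp only [hI]
    refine h1.trans ?_
    rw [ENNReal.tsum_eq_iSup_nat]
    refine iSup_le fun N => ?_
    choose β hβ using fun k => ultra_lim l (fun n => μH[1] (Kn n ∩ A k))
    have h2 : ∀ k, μH[1] (K ∩ A k) ≤ β k := by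
      intro k
      refine le_of_forall_gt_imp_ge_of_dense fun c hc => ?_
      refine hlsc _ (hAo k) c ?_
      exact (((hβ k).eventually (gt_mem_nhds hc)).mono fun n hn => le_of_lt hn).frequently
    calc _ ≤ ∑ k ∈ Finset.range N, ENNReal.ofReal h * β k := by
          gcongr with k hk; exact h2 k
      _ ≤ J + 0 + ENNReal.ofReal h * C := ?_
      _ = _ := by rw [add_zero]
    have ht1 : Tendsto (fun n => ∑ k ∈ Finset.range N, ENNReal.ofReal h * μH[1] (Kn n ∩ A k)) l
        (𝓝 (∑ k ∈ Finset.range N, ENNReal.ofReal h * β k)) :=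
      tendsto_finsetSum _ fun k _ => ENNReal.Tendsto.const_mul (hβ k) (Or.inr ENNReal.ofReal_ne_top)
    have ht2 : Tendsto (fun n => J + ε n + ENNReal.ofReal h * C) l
        (𝓝 (J + 0 + ENNReal.ofReal h * C)) := (tendsto_const_nhds.add hε).add tendsto_const_nhds
    refine le_of_tendsto_of_tendsto' ht1 ht2 fun n => ?_
    calc _ = ∑ k ∈ Finset.range N, ∫⁻ z in Kn n, ENNReal.ofReal h * (A k).indicator 1 z ∂(μH[1]) := by
          simp only [hI]
      _ = ∫⁻ z in Kn n, ∑ k ∈ Finset.range N, ENNReal.ofReal h * (A k).indicator 1 z ∂(μH[1]) := by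
          rw [lintegral_finsetSum _ fun k _ => hmeas k]
      _ ≤ ∫⁻ z in Kn n, (W g z + ENNReal.ofReal h) ∂(μH[1]) := by
          apply lintegral_mono
          intro z
          have := layer_le (hg.pos ‖z‖).le hh N
          simp only [hind] at this
          exact this
      _ = pw g (Kn n) + ENNReal.ofReal h * μH[1] (Kn n) := by
          rw [lintegral_add_left (W_meas hg), pw_apply (hKn n), setLIntegral_const]
      _ ≤ _ := by gcongr; exacts [hP n, hH n]
  have ht : Tendsto (fun h : ℝ => J + ENNReal.ofReal h * C) (𝓝[>] 0) (𝓝 (J + ENNReal.ofReal 0 * C)) := by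
    refine Tendsto.add tendsto_const_nhds (ENNReal.Tendsto.mul_const ?_ (Or.inr hC))
    exact (ENNReal.continuous_ofReal.tendsto 0).mono_left nhdsWithin_le_nhds
  have := ge_of_tendsto ht (eventually_nhdsWithin_of_forall fun h hh => key h hh)
  simpa using this

/-- limit set -/
def LimK (l : Ultrafilter ℕ) (Kn : ℕ → Set ℂ) : Set ℂ :=
  {x | ∀ r > 0, ∃ c > 0, ∀ᶠ n in l, c ≤ μH[1] (Kn n ∩ ball x r)}

lemma notmem_LimK {l : Ultrafilter ℕ} {Kn : ℕ → Set ℂ} {x : ℂ} :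
    x ∉ LimK l Kn ↔ ∃ r > 0, Tendsto (fun n => μH[1] (Kn n ∩ ball x r)) l (𝓝 0) := by
  unfold LimK
  rw [mem_ofPred_eq]
  push Not
  constructor
  · rintro ⟨r, hr, h⟩
    refine ⟨r, hr, ?_⟩
    rw [ENNReal.tendsto_nhds_zero]
    intro c hc
    have := h c hc
    exact this.mono fun n hn => le_of_lt hn
  · rintro ⟨r, hr, h⟩
    refine ⟨r, hr, fun c hc => ?_⟩
    exact h.eventually (gt_mem_nhds hc)

lemma LimK_closed (l : Ultrafilter ℕ) (Kn : ℕ → Set ℂ) : IsClosed (LimK l Kn) := by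
  rw [← isOpen_compl_iff, Metric.isOpen_iff]
  intro x hx
  obtain ⟨r, hr, h⟩ := notmem_LimK.1 hx
  refine ⟨r / 2, by positivity, fun y hy => notmem_LimK.2 ⟨r / 2, by positivity, ?_⟩⟩
  refine tendsto_of_tendsto_of_tendsto_of_le_of_le tendsto_const_nhds h (fun _ => zero_le) fun n => ?_
  refine measure_mono (inter_subset_inter_right _ (ball_subset_ball' ?_))
  rw [mem_ball] at hy; linarith

lemma dens_K (hg : Dens g) {V l0 v1 : ℝ} (hL : Lin g V l0 v1) (l : Ultrafilter ℕ) (U : ℕ → Set ℂ)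
    (hU : ∀ n, IsOpen (U n)) (hUv : ∀ n, nu g (U n) = ENNReal.ofReal V) (ε : ℕ → ℝ≥0∞)
    (hε : Tendsto ε l (𝓝 0)) (hP : ∀ n, P g (U n) ≤ I g (ENNReal.ofReal V) + ε n)
    (x : ℂ) (hx : x ∈ LimK l fun n => frontier (U n)) :
    ∃ η : ℝ, 0 < η ∧ ∀ s, 0 < s → s < η → ∀ q : ℝ, q < 2 * s →
      ∀ᶠ n in l, ENNReal.ofReal q ≤ μH[1] (frontier (U n) ∩ closedBall x s) := by
  obtain ⟨η, hη, hcut⟩ := cut hg hL x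
  refine ⟨η, hη, fun s hs hsη q hq => ?_⟩
  obtain ⟨σ, hσ1, hσ2⟩ : ∃ σ, 0 < σ ∧ σ < s - max q 0 / 2 := by
    have : 0 < s - max q 0 / 2 := by
      rcases max_cases q 0 with h | h <;> rw [h.1] <;> linarith
    exact exists_between this
  have hσs : σ < s := by have := le_max_right q 0; linarith
  obtain ⟨c, hc, hcn⟩ := hx σ hσ1
  have hg0 := g0_pos hg
  have hpos : 0 < ENNReal.ofReal (g 0 / 2) * c := ENNReal.mul_pos (by simpa using hg0) hc.ne'
  filter_upwards [hcn, hε.eventually (gt_mem_nhds hpos), hε.eventually (gt_mem_nhds ENNReal.zero_lt_top)]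
    with n h1 h2 h3
  have h4 : 2 * ENNReal.ofReal (s - σ) ≤ μH[1] (frontier (U n) ∩ closedBall x s) := by
    refine mult2 (u := fun z => dist z x) (LipschitzWith.dist_left x) fun t ht => ?_
    by_contra hcon
    push Not at hcon
    have hs1 : ∃ p, sphere x t ∩ frontier (U n) ⊆ {p} := by
      by_cases hne : (sphere x t ∩ frontier (U n)).Nonempty
      · obtain ⟨p, hp1, hp2⟩ := hne
        refine ⟨p, fun y hy => ?_⟩
        by_contra hyp
        have hb : ∀ z ∈ sphere x t, z ∈ closedBall x s := fun z hz =>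
          mem_closedBall.2 ((mem_sphere.1 hz).le.trans ht.2.le)
        exact hcon y ⟨hy.2, hb y hy.1⟩ p ⟨hp2, hb p hp1⟩ hyp hy.1 hp1
      · exact ⟨0, by rw [not_nonempty_iff_eq_empty.1 hne]; exact empty_subset _⟩
    obtain ⟨p, hp⟩ := hs1
    have h5 := hcut (U n) (hU n) (hUv n) (ε n) h3.ne (hP n) t (hσ1.trans ht.1) (ht.2.trans hsη) p hp
    have h6 : c ≤ μH[1] (frontier (U n) ∩ ball x t) :=
      h1.trans (measure_mono (inter_subset_inter_right _ (ball_subset_ball ht.1.le)))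
    have : ENNReal.ofReal (g 0 / 2) * c ≤ ε n := le_trans (by gcongr) h5
    exact absurd h2 (not_lt.2 this)
  refine le_trans ?_ h4
  rw [← ENNReal.ofReal_ofNat, ← ENNReal.ofReal_mul (by norm_num)]
  apply ENNReal.ofReal_le_ofReal
  have := le_max_left q 0
  linarith

lemma pw_K (hg : Dens g) {V l0 v1 : ℝ} (hL : Lin g V l0 v1) (l : Ultrafilter ℕ) (U : ℕ → Set ℂ)
    (hU : ∀ n, IsOpen (U n)) (hUv : ∀ n, nu g (U n) = ENNReal.ofReal V) (ε : ℕ → ℝ≥0∞)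
    (hε : Tendsto ε l (𝓝 0)) (hε1 : ∀ n, ε n ≤ 1) (hP : ∀ n, P g (U n) ≤ I g (ENNReal.ofReal V) + ε n) :
    pw g (LimK l fun n => frontier (U n)) ≤ I g (ENNReal.ofReal V) := by
  have hg0 := g0_pos hg
  have hI := I_fin hg (v := ENNReal.ofReal V) ENNReal.ofReal_ne_top
  have hKm := (LimK_closed l fun n => frontier (U n)).measurableSet
  have h0 : ENNReal.ofReal (g 0) ≠ 0 := by simpa using hg0
  refine pw_lsc hg l (fun n => frontier (U n)) (fun n => isClosed_frontier.measurableSet) _ hKm _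
    ((I g (ENNReal.ofReal V) + 1) / ENNReal.ofReal (g 0)) ?_ ε hε hP ?_ ?_
  · exact ENNReal.div_ne_top (by simp [hI]) h0
  · intro n
    rw [ENNReal.le_div_iff_mul_le (Or.inl h0) (Or.inl ENNReal.ofReal_ne_top), mul_comm]
    refine (H_le_pw hg isClosed_frontier.measurableSet).trans ((hP n).trans ?_)
    gcongr; exact hε1 n
  · intro A hA c hc
    exact lsc _ _ A hKm hA (fun x hx => dens_K hg hL l U hU hUv ε hε hP x hx) c hc

end Isop
end

section
open Set MeasureTheory Filter Topology Metric
open scoped ENNReal NNReal MeasureTheory Pointwise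
namespace Isop
variable {g : ℝ → ℝ}

lemma nu_reg (hg : Dens g) : (nu g).Regular := by
  have : IsLocallyFiniteMeasure (nu g) :=
    IsLocallyFiniteMeasure.withDensity_ofReal (hg.cont.comp continuous_norm)
  infer_instance

lemma iso_nu (hg : Dens g) {S U : Set ℂ} (hS : MeasurableSet S) (hf : frontier S = frontier U)
    {x : ℂ} {r ρ : ℝ} (hρ : r / 2 < ρ) (hρ2 : ρ < r) (hr : 0 < r)
    (h1 : sphere x ρ ∩ S = ∅) (h2 : sphere x ρ ∩ frontier U = ∅) :
    nu g (ball x (r / 2) ∩ S) ≤ ENNReal.ofReal (g (‖x‖ + r)) *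
      (ENNReal.ofReal (2 * r) * μH[1] (frontier U ∩ ball x r)) := by
  have hρ0 : 0 < ρ := by linarith
  refine (nu_le hg (measurableSet_ball.inter hS) (r := ‖x‖ + r) ?_).trans ?_
  · rintro z ⟨hz, -⟩
    rw [mem_ball, dist_eq_norm] at hz
    have : ‖z‖ ≤ ‖x‖ + ‖z - x‖ := by simpa using norm_add_le x (z - x)
    linarith
  · gcongr
    calc _ ≤ volume (S ∩ ball x ρ) := by
          rw [inter_comm]
          exact measure_mono (inter_subset_inter_right _ (ball_subset_ball hρ.le))
      _ ≤ ENNReal.ofReal (2 * ρ) * μH[1] (frontier S ∩ ball x ρ) :=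
          iso (p := x) hρ0 h1 (by rw [hf, h2]; exact empty_subset _)
      _ ≤ _ := by
          rw [hf]
          gcongr

lemma alt (hg : Dens g) {U : Set ℂ} (hU : IsOpen U) {x : ℂ} {r : ℝ} (hr : 0 < r)
    (hH : μH[1] (frontier U ∩ ball x r) < ENNReal.ofReal (r / 2)) :
    nu g (ball x (r / 2) ∩ U) ≤ ENNReal.ofReal (g (‖x‖ + r)) *
      (ENNReal.ofReal (2 * r) * μH[1] (frontier U ∩ ball x r)) ∨
    nu g (ball x (r / 2) ∩ Uᶜ) ≤ ENNReal.ofReal (g (‖x‖ + r)) *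
      (ENNReal.ofReal (2 * r) * μH[1] (frontier U ∩ ball x r)) := by
  obtain ⟨ρ, hρ1, hρ2, hρ⟩ : ∃ ρ, r / 2 < ρ ∧ ρ < r ∧ sphere x ρ ∩ frontier U = ∅ := by
    by_contra hcon
    push Not at hcon
    have : Ioo (r / 2) r ⊆ (fun z => dist z x) '' (frontier U ∩ ball x r) := by
      rintro t ⟨h1, h2⟩
      obtain ⟨z, hz1, hz2⟩ := hcon t h1 h2
      exact ⟨z, ⟨hz2, by rw [mem_ball]; rw [mem_sphere] at hz1; linarith⟩, hz1⟩
    have h := mult1 (LipschitzWith.dist_left x) this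
    rw [Real.volume_Ioo, show r - r / 2 = r / 2 by ring] at h
    exact absurd hH (not_lt.2 h)
  rcases circ_alt (p := x) hU (by rw [hρ]; exact empty_subset _) with h | h
  · exact Or.inl (iso_nu hg hU.measurableSet rfl hρ1 hρ2 hr h hρ)
  · refine Or.inr (iso_nu hg hU.measurableSet.compl (frontier_compl U) hρ1 hρ2 hr ?_ hρ)
    rw [eq_empty_iff_forall_notMem]
    rintro z ⟨hz1, hz2⟩
    refine hz2 (h ⟨hz1, fun hz3 => ?_⟩)
    have : z ∈ sphere x ρ ∩ frontier U := ⟨hz1, hz3⟩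
    rw [hρ] at this; exact this

/-- locally null limits -/
def LN (g : ℝ → ℝ) (l : Ultrafilter ℕ) (S : ℕ → Set ℂ) : Set ℂ :=
  {x | ∃ r > 0, Tendsto (fun n => nu g (ball x r ∩ S n)) l (𝓝 0)}

lemma LN_open (l : Ultrafilter ℕ) (S : ℕ → Set ℂ) : IsOpen (LN g l S) := by
  rw [Metric.isOpen_iff]
  rintro x ⟨r, hr, h⟩
  refine ⟨r / 2, by positivity, fun y hy => ⟨r / 2, by positivity, ?_⟩⟩
  refine tendsto_of_tendsto_of_tendsto_of_le_of_le tendsto_const_nhds h (fun _ => zero_le) fun n => ?_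
  refine measure_mono (inter_subset_inter_left _ (ball_subset_ball' ?_))
  rw [mem_ball] at hy; linarith

lemma LN_compact (l : Ultrafilter ℕ) (S : ℕ → Set ℂ) {C : Set ℂ} (hC : IsCompact C)
    (h : C ⊆ LN g l S) : Tendsto (fun n => nu g (C ∩ S n)) l (𝓝 0) := by
  refine hC.induction_on (p := fun C => Tendsto (fun n => nu g (C ∩ S n)) l (𝓝 0)) ?_ ?_ ?_ ?_
  · simp
  · intro s t hst ht
    exact tendsto_of_tendsto_of_tendsto_of_le_of_le tendsto_const_nhds ht (fun _ => zero_le) fun n =>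
      measure_mono (inter_subset_inter_left _ hst)
  · intro s t hs ht
    have := hs.add ht
    rw [add_zero] at this
    refine tendsto_of_tendsto_of_tendsto_of_le_of_le tendsto_const_nhds this (fun _ => zero_le) fun n => ?_
    show nu g ((s ∪ t) ∩ S n) ≤ _
    rw [union_inter_distrib_right]
    exact measure_union_le _ _
  · intro x hx
    obtain ⟨r, hr, h'⟩ := h hx
    exact ⟨ball x r, mem_nhdsWithin_of_mem_nhds (ball_mem_nhds x hr), h'⟩

lemma nu_ball_pos (hg : Dens g) (x : ℂ) {r : ℝ} (hr : 0 < r) : 0 < nu g (ball x r) := by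
  have h := nu_ge hg le_rfl (A := ball x r) measurableSet_ball fun z _ => norm_nonneg z
  refine lt_of_lt_of_le (ENNReal.mul_pos ?_ ?_) h
  · simpa using g0_pos hg
  · exact (measure_ball_pos volume x hr).ne'

lemma LN_disj (hg : Dens g) (l : Ultrafilter ℕ) (U : ℕ → Set ℂ) :
    Disjoint (LN g l U) (LN g l fun n => (U n)ᶜ) := by
  rw [Set.disjoint_left]
  rintro x ⟨r, hr, h⟩ ⟨s, hs, h'⟩
  have hm : 0 < min r s := lt_min hr hs
  have h3 := h.add h'
  rw [add_zero] at h3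
  have h4 : nu g (ball x (min r s)) ≤ 0 := by
    refine ge_of_tendsto' h3 fun n => ?_
    calc nu g (ball x (min r s)) ≤ nu g ((ball x r ∩ U n) ∪ (ball x s ∩ (U n)ᶜ)) := by
          refine measure_mono fun z hz => ?_
          by_cases hzU : z ∈ U n
          · exact Or.inl ⟨ball_subset_ball (min_le_left _ _) hz, hzU⟩
          · exact Or.inr ⟨ball_subset_ball (min_le_right _ _) hz, hzU⟩
      _ ≤ _ := measure_union_le _ _
  exact absurd (nu_ball_pos hg x hm) (not_lt.2 h4)

lemma LN_cover (hg : Dens g) (l : Ultrafilter ℕ) (U : ℕ → Set ℂ) (hU : ∀ n, IsOpen (U n)) {x : ℂ}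
    (hx : x ∉ LimK l fun n => frontier (U n)) :
    x ∈ LN g l U ∨ x ∈ LN g l fun n => (U n)ᶜ := by
  obtain ⟨r, hr, h⟩ := notmem_LimK.1 hx
  have hT : Tendsto (fun n => ENNReal.ofReal (g (‖x‖ + r)) *
      (ENNReal.ofReal (2 * r) * μH[1] (frontier (U n) ∩ ball x r))) l (𝓝 0) := by
    have := ENNReal.Tendsto.const_mul (a := ENNReal.ofReal (g (‖x‖ + r)))
      (ENNReal.Tendsto.const_mul (a := ENNReal.ofReal (2 * r)) h (Or.inr ENNReal.ofReal_ne_top))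
      (Or.inr ENNReal.ofReal_ne_top)
    simpa using this
  have hev : ∀ᶠ n in l, μH[1] (frontier (U n) ∩ ball x r) < ENNReal.ofReal (r / 2) :=
    h.eventually (gt_mem_nhds (by simpa using hr))
  have := hev.mono fun n hn => alt hg (hU n) hr hn
  rcases Ultrafilter.eventually_or.1 this with h1 | h1
  · exact Or.inl ⟨r / 2, by positivity, tendsto_of_tendsto_of_tendsto_of_le_of_le' tendsto_const_nhds hT
      (Eventually.of_forall fun _ => zero_le) h1⟩
  · exact Or.inr ⟨r / 2, by positivity, tendsto_of_tendsto_of_tendsto_of_le_of_le' tendsto_const_nhds hT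
      (Eventually.of_forall fun _ => zero_le) h1⟩

lemma LN_frontier (hg : Dens g) (l : Ultrafilter ℕ) (U : ℕ → Set ℂ) (hU : ∀ n, IsOpen (U n)) :
    frontier (LN g l fun n => (U n)ᶜ) ⊆ LimK l fun n => frontier (U n) := by
  intro x hx
  by_contra hK
  have ho := LN_open (g := g) l fun n => (U n)ᶜ
  rw [ho.frontier_eq] at hx
  rcases LN_cover hg l U hU hK with h | h
  · obtain ⟨z, hz1, hz2⟩ := mem_closure_iff.1 hx.1 _ (LN_open l U) h
    exact Set.disjoint_left.1 (LN_disj hg l U) hz1 hz2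
  · exact hx.2 h

lemma tail_unif (hg : Dens g) {C τ : ℝ≥0∞} (hC : C ≠ ∞) (hτ : 0 < τ) :
    ∃ R : ℝ, ∀ U, IsOpen U → nu g U ≠ ∞ → P g U ≤ C → nu g (U \ ball 0 R) ≤ τ := by
  have h0 : Tendsto (fun R => ENNReal.ofReal (g R)) atTop (𝓝 ∞) :=
    ENNReal.tendsto_ofReal_nhds_top.2 hg.inf
  have h1 : Tendsto (fun R => ENNReal.ofReal (g R) * c1) atTop (𝓝 ∞) := by
    have := ENNReal.Tendsto.mul_const (b := c1) h0 (Or.inl ENNReal.top_ne_zero)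
    rwa [ENNReal.top_mul c1_pos.ne'] at this
  have h2 : Tendsto (fun R => ENNReal.ofReal (g R) * τ) atTop (𝓝 ∞) := by
    have := ENNReal.Tendsto.mul_const (b := τ) h0 (Or.inl ENNReal.top_ne_zero)
    rwa [ENNReal.top_mul hτ.ne'] at this
  have hfin : ENNReal.ofReal Real.pi * C * C < ∞ :=
    ENNReal.mul_lt_top (ENNReal.mul_lt_top ENNReal.ofReal_lt_top hC.lt_top) hC.lt_top
  obtain ⟨R, hR1, hR2, hR3⟩ := ((h1.eventually (lt_mem_nhds hC.lt_top)).and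
    ((h2.eventually (lt_mem_nhds hfin)).and (eventually_ge_atTop (1:ℝ)))).exists
  refine ⟨R, fun U hU hUf hP => ?_⟩
  have h3 := tail hg hU hUf (R := R) (by linarith) (lt_of_le_of_lt hP (hR1.trans_le (by
    gcongr
    calc c1 = ENNReal.ofReal 1 * c1 := by simp
      _ ≤ _ := by gcongr)))
  have h4 : ENNReal.ofReal (g R) * nu g (U \ ball 0 R) ≤ ENNReal.ofReal (g R) * τ := by
    refine h3.trans (le_trans ?_ hR2.le)
    gcongr
  exact (ENNReal.mul_le_mul_iff_right (by simpa using hg.pos R) ENNReal.ofReal_ne_top).1 h4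

lemma limit (hg : Dens g) {V l0 v1 : ℝ} (hL : Lin g V l0 v1) (l : Ultrafilter ℕ) (U : ℕ → Set ℂ)
    (hU : ∀ n, IsOpen (U n)) (hUv : ∀ n, nu g (U n) = ENNReal.ofReal V) (ε : ℕ → ℝ≥0∞)
    (hε : Tendsto ε l (𝓝 0)) (hε1 : ∀ n, ε n ≤ 1) (hP : ∀ n, P g (U n) ≤ I g (ENNReal.ofReal V) + ε n) :
    ∃ Ω, IsOpen Ω ∧ nu g Ω = ENNReal.ofReal V ∧ P g Ω ≤ I g (ENNReal.ofReal V) := by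
  have hI := I_fin hg (v := ENNReal.ofReal V) ENNReal.ofReal_ne_top
  have hKpw := pw_K hg hL l U hU hUv ε hε hε1 hP
  set K := LimK l fun n => frontier (U n) with hK
  have hKm : MeasurableSet K := (LimK_closed l fun n => frontier (U n)).measurableSet
  have hK0 : nu g K = 0 := nu_null hg (H_fin hg hKm (ne_top_of_le_ne_top hI hKpw))
  have hreg := nu_reg hg
  refine ⟨LN g l fun n => (U n)ᶜ, LN_open _ _, le_antisymm ?_ ?_, ?_⟩
  · rw [(LN_open l _).measure_eq_iSup_isCompact]
    refine iSup₂_le fun C hC => iSup_le fun hCc => ?_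
    have h1 := LN_compact l _ hCc hC
    have h2 := (tendsto_const_nhds (x := ENNReal.ofReal V)).add h1
    rw [add_zero] at h2
    refine ge_of_tendsto' h2 fun n => ?_
    calc nu g C = nu g ((C ∩ U n) ∪ (C ∩ (U n)ᶜ)) := by rw [inter_union_compl]
      _ ≤ nu g (C ∩ U n) + nu g (C ∩ (U n)ᶜ) := measure_union_le _ _
      _ ≤ _ := by
        gcongr
        rw [← hUv n]; exact measure_mono inter_subset_right
  · set Ω := LN g l fun n => (U n)ᶜ with hΩ
    have key : ∀ τ : ℝ≥0∞, 0 < τ → ENNReal.ofReal V ≤ nu g Ω + (τ + τ) := by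
      intro τ hτ
      obtain ⟨R, hR⟩ := tail_unif hg (C := I g (ENNReal.ofReal V) + 1) (by simp [hI]) hτ
      have ho : IsOpen (ball (0:ℂ) R ∩ LN g l U) := isOpen_ball.inter (LN_open _ _)
      have hfin : nu g (ball (0:ℂ) R ∩ LN g l U) ≠ ∞ :=
        ((measure_mono inter_subset_left).trans_lt (nu_ball_lt hg R)).ne
      obtain ⟨C, hCs, hCc, hC⟩ := ho.measurableSet.exists_isCompact_sdiff_lt hfin hτ.ne'
      have h1 := LN_compact l U hCc (hCs.trans inter_subset_right)
      have h2 := (tendsto_const_nhds (x := nu g Ω + (τ + τ))).add h1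
      rw [add_zero] at h2
      refine ge_of_tendsto' h2 fun n => ?_
      have hsub : U n ⊆ (((Ω ∪ K) ∪ (U n \ ball 0 R)) ∪ ((ball (0:ℂ) R ∩ LN g l U) \ C)) ∪ (C ∩ U n) := by
        intro z hz
        by_cases hb : z ∈ ball (0:ℂ) R
        · by_cases hk : z ∈ K
          · exact Or.inl (Or.inl (Or.inl (Or.inr hk)))
          · rcases LN_cover hg l U hU hk with h | h
            · by_cases hc : z ∈ C
              · exact Or.inr ⟨hc, hz⟩
              · exact Or.inl (Or.inr ⟨⟨hb, h⟩, hc⟩)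
            · exact Or.inl (Or.inl (Or.inl (Or.inl h)))
        · exact Or.inl (Or.inl (Or.inr ⟨hz, hb⟩))
      have hr := hR (U n) (hU n) (by rw [hUv]; exact ENNReal.ofReal_ne_top)
        ((hP n).trans (by gcongr; exact hε1 n))
      calc ENNReal.ofReal V = nu g (U n) := (hUv n).symm
        _ ≤ _ := measure_mono hsub
        _ ≤ (((nu g Ω + nu g K) + nu g (U n \ ball 0 R)) + nu g ((ball (0:ℂ) R ∩ LN g l U) \ C))
            + nu g (C ∩ U n) := by
          refine (measure_union_le _ _).trans ?_
          gcongr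
          refine (measure_union_le _ _).trans ?_
          gcongr
          refine (measure_union_le _ _).trans ?_
          gcongr
          exact measure_union_le _ _
        _ ≤ (((nu g Ω + 0) + τ) + τ) + nu g (C ∩ U n) := by
          rw [hK0]; gcongr
        _ = _ := by rw [add_zero, add_assoc (nu g Ω)]
    have ht : Tendsto (fun τ : ℝ≥0∞ => nu g Ω + (τ + τ)) (𝓝[>] 0) (𝓝 (nu g Ω + (0 + 0))) := by
      refine Tendsto.mono_left ?_ nhdsWithin_le_nhds
      exact Continuous.tendsto (by fun_prop) 0
    have := ge_of_tendsto ht (eventually_nhdsWithin_of_forall fun τ hτ => key τ hτ)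
    simpa using this
  · exact (measure_mono (LN_frontier hg l U hU)).trans hKpw

theorem main (hg : Dens g) {V : ℝ} (hV : 0 < V) :
    ∃ Ω, IsOpen Ω ∧ nu g Ω = ENNReal.ofReal V ∧
      ∀ U, IsOpen U → nu g U = ENNReal.ofReal V → P g Ω ≤ P g U := by
  have hI := I_fin hg (v := ENNReal.ofReal V) ENNReal.ofReal_ne_top
  suffices h : ∃ Ω, IsOpen Ω ∧ nu g Ω = ENNReal.ofReal V ∧ P g Ω ≤ I g (ENNReal.ofReal V) by
    obtain ⟨Ω, h1, h2, h3⟩ := h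
    refine ⟨Ω, h1, h2, fun U hU hUv => h3.trans (I_le hU hUv.ge ?_)⟩
    rw [hUv]; exact ENNReal.ofReal_ne_top
  obtain ⟨R, hR⟩ := exists_ball hg (v := ENNReal.ofReal V) ENNReal.ofReal_ne_top
  rcases le_or_gt (P g (ball 0 R)) (I g (ENNReal.ofReal V)) with h | h
  · exact ⟨_, isOpen_ball, hR, h⟩
  · obtain ⟨l0, v1, hL⟩ := lin_bound hg hV hR h
    have hex : ∀ n : ℕ, ∃ U, IsOpen U ∧ nu g U = ENNReal.ofReal V ∧
        P g U < I g (ENNReal.ofReal V) + ((n:ℝ≥0∞) + 1)⁻¹ := fun n =>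
      I_exists hg (ENNReal.lt_add_right hI (by simp))
    choose U hU hUv hP using hex
    refine limit hg (l0 := l0) (v1 := v1) hL (hyperfilter ℕ) U hU hUv (fun n => ((n:ℝ≥0∞) + 1)⁻¹) ?_ ?_
      fun n => (hP n).le
    · have h1 : Tendsto (fun n : ℕ => ((n:ℝ≥0∞) + 1)⁻¹) atTop (𝓝 0) := by
        have := (tendsto_add_atTop_iff_nat 1).2 ENNReal.tendsto_inv_nat_nhds_zero
        simpa using this
      exact h1.mono_left Nat.hyperfilter_le_atTop
    · intro n
      rw [ENNReal.inv_le_one]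
      simp
end Isop
end

section
open Set MeasureTheory Filter Topology Metric
open scoped ENNReal NNReal MeasureTheory Pointwise
namespace Isop

noncomputable def eqv : ℂ ≃ₗᵢ[ℝ] EuclideanSpace ℝ (Fin 2) := Complex.orthonormalBasisOneI.repr

lemma eqv_mp : MeasurePreserving eqv volume volume :=
  Complex.orthonormalBasisOneI.measurePreserving_repr

lemma eqv_mpH : MeasurePreserving eqv μH[1] μH[1] :=
  eqv.toIsometryEquiv.measurePreserving_hausdorffMeasure 1

lemma eqv_emb : MeasurableEmbedding eqv := eqv.toHomeomorph.measurableEmbedding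

lemma wvol_eq {f : EuclideanSpace ℝ (Fin 2) → ℝ} {G : ℝ → ℝ} (h : ∀ x, f x = G ‖x‖)
    (Ω : Set (EuclideanSpace ℝ (Fin 2))) : wvol f Ω = nu G (eqv ⁻¹' Ω) := by
  rw [nu_apply, wvol, ← eqv_mp.setLIntegral_comp_preimage_emb eqv_emb]
  simp only [h, W, LinearIsometryEquiv.norm_map]

lemma wper_eq {f : EuclideanSpace ℝ (Fin 2) → ℝ} {G : ℝ → ℝ} (h : ∀ x, f x = G ‖x‖)
    (Ω : Set (EuclideanSpace ℝ (Fin 2))) : wper f Ω = P G (eqv ⁻¹' Ω) := by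
  have hf : frontier (eqv ⁻¹' Ω) = eqv ⁻¹' (frontier Ω) :=
    (eqv.toHomeomorph.preimage_frontier Ω).symm
  rw [P, hf, pw_apply (eqv.continuous.measurable isClosed_frontier.measurableSet), wper,
    ← eqv_mpH.setLIntegral_comp_preimage_emb eqv_emb]
  simp only [h, W, LinearIsometryEquiv.norm_map]

end Isop
end

/-- In the plane endowed with a continuous, nondecreasing, radial
density `f(x) = g(|x|)` with `g(r) → +∞` as `r → +∞`, isoperimetric regions of any
given weighted volume `V > 0` exist. -/
theorem exists_isoperimetric_region_plane_radial
    (f : EuclideanSpace ℝ (Fin 2) → ℝ) (g : ℝ → ℝ)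
    (hcont : Continuous f)
    (hfg : ∀ x : EuclideanSpace ℝ (Fin 2), f x = g ‖x‖)
    (hgpos : ∀ r : ℝ, 0 ≤ r → 0 < g r)
    (hgmono : ∀ r s : ℝ, 0 ≤ r → r ≤ s → g r ≤ g s)
    (hginf : Tendsto g atTop atTop)
    (V : ℝ) (hV : 0 < V) :
    ∃ Ω : Set (EuclideanSpace ℝ (Fin 2)), IsIsopRegion f Ω (ENNReal.ofReal V) := by
  have hG : ∀ x, f x = (fun r => g |r|) ‖x‖ := fun x => by simp [hfg]
  have hD : Isop.Dens (fun r => g |r|) := by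
    refine ⟨?_, fun r => hgpos _ (abs_nonneg r), ?_, ?_⟩
    · have h : (fun r : ℝ => g |r|) = fun r : ℝ => f (Isop.eqv (r : ℂ)) := by
        funext r
        rw [hfg, LinearIsometryEquiv.norm_map]
        simp
      rw [h]
      exact hcont.comp (Isop.eqv.continuous.comp Complex.continuous_ofReal)
    · intro r s hr hrs
      exact hgmono _ _ (abs_nonneg r) (abs_le_abs_of_nonneg hr hrs)
    · exact hginf.comp tendsto_abs_atTop_atTop
  obtain ⟨Ω, h1, h2, h3⟩ := Isop.main hD hV
  have hpre : Isop.eqv ⁻¹' (Isop.eqv.symm ⁻¹' Ω) = Ω := by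
    ext z; simp
  refine ⟨Isop.eqv.symm ⁻¹' Ω, h1.preimage Isop.eqv.symm.continuous, ?_, ?_⟩
  · rw [Isop.wvol_eq (G := fun r => g |r|) hG, hpre, h2]
  · intro U hU hUV
    rw [Isop.wvol_eq (G := fun r => g |r|) hG] at hUV
    rw [Isop.wper_eq (G := fun r => g |r|) hG, Isop.wper_eq (G := fun r => g |r|) hG, hpre]
    exact h3 _ (hU.preimage Isop.eqv.continuous) hUV
end
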